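/- Assume (H) with m > 2d, and adopt the notation of the context (window g, norm ‖·‖_{W^{1,∞}}, kernel E, measure ν, nonlinearity G). Then for every R > 0 there exists T = T(R) ∈ (0,1] with the following property: for every h ∈ L¹(ℝ^d) with ‖h‖_{L¹} ≤ R, setting f(x) := ∫_{ℝ^d} e^{2πi x·ξ} h(ξ) dξ, there exists a unique family (u(t,·))_{t∈[0,T]} of bounded continuous functions on ℝ^d with ‖u(t,·)‖_{W^{1,∞}} < ∞ for all t, such that t ↦ u(t,·) is continuous with respect to ‖·‖_{W^{1,∞}}, u(0,·) = f, and for every t ∈ (0,T] and x ∈ ℝ^d, u(t,x) = ∫_{ℝ^d} e^{2πi(x·ξ + tμ(ξ))} h(ξ) dξ + 2πi ∫₀^t ( ∫_{ℝ^d} E(t−s, x−y) G(u(s,y)) dν(y) ) ds, where for each s ∈ (0,t) the inner integral converges absolutely and the function s ↦ ∫ E(t−s,x−y)G(u(s,y)) dν(y) is absolutely integrable on (0,t). Moreover, the datum-to-solution map is Lipschitz: there exists L > 0 such that if h₁, h₂ ∈ L¹(ℝ^d) with ‖h₁‖_{L¹}, ‖h₂‖_{L¹} ≤ R have solutions u₁,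 u₂, then sup_{t∈[0,T]} ‖u₁(t,·) − u₂(t,·)‖_{W^{1,∞}} ≤ L ‖h₁ − h₂‖_{L¹}. -/

import Mathlib

open MeasureTheory Real Complex
open scoped ENNReal RealInnerProductSpace

noncomputable section

/-- The Gabor (short-time Fourier) transform `V_g v(x,ξ)` of a function `v` with respect to a
Schwartz window `g`. -/
def gaborT (d : ℕ) (g : SchwartzMap (EuclideanSpace ℝ (Fin d)) ℂ)
    (v : EuclideanSpace ℝ (Fin d) → ℂ) (x ξ : EuclideanSpace ℝ (Fin d)) : ℂ :=
  ∫ (y : EuclideanSpace ℝ (Fin d)),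
    Complex.exp (-(((2 * Real.pi * ⟪ξ, y⟫ : ℝ) : ℂ) * Complex.I)) * v y *
      (starRingEnd ℂ) (g (y - x))

/-- The Wiener amalgam `W^{1,∞}` norm `sup_x ∫ |V_g v(x,ξ)| dξ` (valued in `ℝ≥0∞`). -/
def wOneInfNorm (d : ℕ) (g : SchwartzMap (EuclideanSpace ℝ (Fin d)) ℂ)
    (v : EuclideanSpace ℝ (Fin d) → ℂ) : ℝ≥0∞ :=
  ⨆ x : EuclideanSpace ℝ (Fin d),
    ∫⁻ ξ : EuclideanSpace ℝ (Fin d), (‖gaborT d g v x ξ‖₊ : ℝ≥0∞) ∂volume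

/-- `u` is a solution on `[0,T]` of the Duhamel formulation of
`(1/2πi)∂_t u = μ(D)u + ν·G(u)`, `u(0) = f = (h)^∨`, where the finite complex measure `ν`
is represented as `w dρ` with `ρ` a finite positive measure and `w` a bounded density, and
`E(t,·)` is the inverse Fourier transform of `e^{2πitμ}`. -/
def IsSolutionOn (d : ℕ) (T : ℝ) (μ : EuclideanSpace ℝ (Fin d) → ℝ)
    (g : SchwartzMap (EuclideanSpace ℝ (Fin d)) ℂ)
    (EE : ℝ → EuclideanSpace ℝ (Fin d) → ℂ)
    (ρ : Measure (EuclideanSpace ℝ (Fin d))) (w : EuclideanSpace ℝ (Fin d) → ℂ)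
    (G : ℂ → ℂ) (h : EuclideanSpace ℝ (Fin d) → ℂ)
    (u : ℝ → EuclideanSpace ℝ (Fin d) → ℂ) : Prop :=
  (∀ t ∈ Set.Icc (0 : ℝ) T,
    Continuous (u t) ∧ (∃ M : ℝ, ∀ x, ‖u t x‖ ≤ M) ∧ wOneInfNorm d g (u t) < ⊤) ∧
  (∀ t ∈ Set.Icc (0 : ℝ) T, ∀ ε : ℝ, 0 < ε → ∃ δ : ℝ, 0 < δ ∧
    ∀ s ∈ Set.Icc (0 : ℝ) T, |s - t| < δ →
      wOneInfNorm d g (fun x => u s x - u t x) < ENNReal.ofReal ε) ∧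
  (∀ x, u 0 x =
    ∫ (ξ : EuclideanSpace ℝ (Fin d)),
      Complex.exp (((2 * Real.pi * ⟪x, ξ⟫ : ℝ) : ℂ) * Complex.I) * h ξ) ∧
  (∀ t ∈ Set.Ioc (0 : ℝ) T, ∀ x : EuclideanSpace ℝ (Fin d),
    (∀ s ∈ Set.Ioo (0 : ℝ) t,
      Integrable (fun y => EE (t - s) (x - y) * G (u s y) * w y) ρ) ∧
    IntegrableOn (fun s => ∫ y, EE (t - s) (x - y) * G (u s y) * w y ∂ρ)
      (Set.Ioo (0 : ℝ) t) volume ∧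
    u t x =
      (∫ (ξ : EuclideanSpace ℝ (Fin d)),
        Complex.exp (((2 * Real.pi * (⟪x, ξ⟫ + t * μ ξ) : ℝ) : ℂ) * Complex.I) * h ξ) +
      (2 * (Real.pi : ℂ)) * Complex.I *
        ∫ s in Set.Ioo (0 : ℝ) t, ∫ y, EE (t - s) (x - y) * G (u s y) * w y ∂ρ)

section PartSec1

/-! ## Part 1: homogeneous functions -/

/-- Smooth off the origin, homogeneous of degree `s`, zero at the origin. -/
def IsHom {E F : Type} [NormedAddCommGroup E] [NormedSpace ℝ E] [NormedAddCommGroup F]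
    [NormedSpace ℝ F] (f : E → F) (s : ℝ) : Prop :=
  ContDiffOn ℝ (⊤ : ℕ∞) f {x | x ≠ 0} ∧
    (∀ c : ℝ, 0 < c → ∀ x : E, x ≠ 0 → f (c • x) = c ^ s • f x) ∧ f 0 = 0

section hom
variable {E : Type} [NormedAddCommGroup E] [NormedSpace ℝ E] [FiniteDimensional ℝ E]

theorem IsHom.bound {F : Type} [NormedAddCommGroup F] [NormedSpace ℝ F] {f : E → F} {s : ℝ}
    (hf : IsHom f s) : ∃ M : ℝ, 0 ≤ M ∧ ∀ x, ‖f x‖ ≤ M * ‖x‖ ^ s := by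
  obtain ⟨h1, h2, h3⟩ := hf
  haveI : ProperSpace E := FiniteDimensional.proper ℝ E
  have hc : ContinuousOn f (Metric.sphere (0 : E) 1) :=
    h1.continuousOn.mono (fun x hx => by
      simp only [Set.mem_setOf_eq]; rintro rfl; simp at hx)
  obtain ⟨M, hM⟩ := (isCompact_sphere (0 : E) 1).exists_bound_of_continuousOn hc
  refine ⟨max M 0, le_max_right _ _, fun x => ?_⟩
  by_cases hx : x = 0
  · subst hx; rw [h3, norm_zero]; positivity
  · have hn : 0 < ‖x‖ := norm_pos_iff.mpr hx
    have hx' : ‖x‖⁻¹ • x ≠ 0 := smul_ne_zero (inv_ne_zero hn.ne') hx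
    have e : f x = ‖x‖ ^ s • f (‖x‖⁻¹ • x) := by
      rw [← h2 _ hn _ hx', smul_smul, mul_inv_cancel₀ hn.ne', one_smul]
    rw [e, norm_smul, Real.norm_of_nonneg (by positivity), mul_comm]
    gcongr
    refine (hM _ ?_).trans (le_max_left _ _)
    simp [norm_smul, hn.ne']

theorem IsHom.continuous {F : Type} [NormedAddCommGroup F] [NormedSpace ℝ F] {f : E → F} {s : ℝ}
    (hf : IsHom f s) (hs : 0 < s) : Continuous f := by
  obtain ⟨M, hM0, hM⟩ := hf.bound
  rw [continuous_iff_continuousAt]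
  intro x
  by_cases hx : x = 0
  · subst hx
    rw [ContinuousAt, hf.2.2]
    refine squeeze_zero_norm hM ?_
    have : Continuous fun x : E => M * ‖x‖ ^ s :=
      continuous_const.mul (continuous_norm.rpow_const (fun _ => Or.inr hs.le))
    simpa [Real.zero_rpow hs.ne'] using this.tendsto 0
  · exact hf.1.continuousOn.continuousAt (isOpen_ne.mem_nhds hx)

theorem IsHom.hasFDerivAt_zero {F : Type} [NormedAddCommGroup F] [NormedSpace ℝ F] {f : E → F}
    {s : ℝ} (hf : IsHom f s) (hs : 1 < s) : HasFDerivAt f (0 : E →L[ℝ] F) 0 := by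
  obtain ⟨M, hM0, hM⟩ := hf.bound
  rw [hasFDerivAt_iff_isLittleO_nhds_zero]
  simp only [zero_add, hf.2.2, sub_zero, ContinuousLinearMap.zero_apply]
  rw [Asymptotics.isLittleO_iff]
  intro ε hε
  have hcont : Continuous fun x : E => M * ‖x‖ ^ (s - 1) :=
    continuous_const.mul (continuous_norm.rpow_const (fun _ => Or.inr (by linarith)))
  have : ∀ᶠ x in nhds (0 : E), M * ‖x‖ ^ (s - 1) < ε := by
    apply hcont.continuousAt.eventually_lt_const
    simpa [Real.zero_rpow (show s - 1 ≠ 0 by linarith)] using hε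
  filter_upwards [this] with x hx
  by_cases h0 : x = 0
  · subst h0; simp [hf.2.2]
  have hn : 0 < ‖x‖ := norm_pos_iff.mpr h0
  calc ‖f x‖ ≤ M * ‖x‖ ^ s := hM x
    _ = M * ‖x‖ ^ (s - 1) * ‖x‖ := by
        rw [mul_assoc]; congr 1
        conv_rhs => rw [← Real.rpow_one ‖x‖, ← Real.rpow_mul hn.le, one_mul, ← Real.rpow_add hn]
        congr 1; ring
    _ ≤ ε * ‖x‖ := by gcongr

theorem IsHom.fderiv {F : Type} [NormedAddCommGroup F] [NormedSpace ℝ F] {f : E → F}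
    {s : ℝ} (hf : IsHom f s) (hs : 1 < s) : IsHom (fderiv ℝ f) (s - 1) := by
  refine ⟨hf.1.fderiv_of_isOpen isOpen_ne (by simp), ?_, (hf.hasFDerivAt_zero hs).fderiv⟩
  intro c hc x hx
  have hcx : c • x ≠ 0 := smul_ne_zero hc.ne' hx
  have hd : ∀ y : E, y ≠ 0 → DifferentiableAt ℝ f y := fun y hy =>
    (hf.1.contDiffAt (isOpen_ne.mem_nhds hy)).differentiableAt (by simp)
  have h1 : HasFDerivAt (fun y => f (c • y))
      ((_root_.fderiv ℝ f (c • x)).comp (c • ContinuousLinearMap.id ℝ E)) x := by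
    have := (hd _ hcx).hasFDerivAt
    exact this.comp x ((hasFDerivAt_id x).const_smul c)
  have h2 : HasFDerivAt (fun y => f (c • y)) (c ^ s • _root_.fderiv ℝ f x) x := by
    refine ((hd x hx).hasFDerivAt.const_smul (c ^ s)).congr_of_eventuallyEq ?_
    filter_upwards [isOpen_ne.mem_nhds hx] with y hy
    exact hf.2.1 c hc y hy
  have h3 := h1.unique h2
  have h4 : c • _root_.fderiv ℝ f (c • x) = c ^ s • _root_.fderiv ℝ f x := by
    rw [← h3]; ext; simp
  rw [Real.rpow_sub_one hc.ne', div_eq_inv_mul, mul_smul, ← h4, smul_smul,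
    inv_mul_cancel₀ hc.ne', one_smul]

theorem IsHom.contDiff (k : ℕ) : ∀ {F : Type} [NormedAddCommGroup F] [NormedSpace ℝ F] {f : E → F}
    {s : ℝ}, IsHom f s → (k : ℝ) < s → ContDiff ℝ k f ∧
      ∀ j ≤ k, ∃ M : ℝ, 0 ≤ M ∧ ∀ x, ‖iteratedFDeriv ℝ j f x‖ ≤ M * ‖x‖ ^ (s - j) := by
  induction k with
  | zero =>
    intro F _ _ f s hf hs
    refine ⟨contDiff_zero.mpr (hf.continuous (by simpa using hs)), ?_⟩
    intro j hj
    obtain rfl : j = 0 := by omega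
    simpa using hf.bound
  | succ k ih =>
    intro F _ _ f s hf hs
    push_cast at hs
    have hk : (0 : ℝ) ≤ k := Nat.cast_nonneg k
    have h1 : 1 < s := by linarith
    obtain ⟨i1, i2⟩ := ih (hf.fderiv h1) (by linarith)
    refine ⟨?_, ?_⟩
    · push_cast
      rw [contDiff_succ_iff_fderiv]
      refine ⟨?_, by simp, i1⟩
      intro y
      by_cases hy : y = 0
      · subst hy; exact (hf.hasFDerivAt_zero h1).differentiableAt
      · exact (hf.1.contDiffAt (isOpen_ne.mem_nhds hy)).differentiableAt (by simp)
    · intro j hj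
      cases j with
      | zero => simpa using hf.bound
      | succ j =>
        obtain ⟨M, hM0, hM⟩ := i2 j (by omega)
        refine ⟨M, hM0, fun x => ?_⟩
        rw [← norm_iteratedFDeriv_fderiv]
        convert hM x using 3
        push_cast; ring
end hom

end PartSec1

section PartSec2

set_option linter.unusedSectionVars false
/-! ## Part 2: pointwise bound for the oscillatory integral -/

/-- The character `x ↦ e^{2πix}`. -/
def ee (x : ℝ) : ℂ := Complex.exp (((2 * Real.pi * x : ℝ) : ℂ) * Complex.I)

theorem norm_ee (x : ℝ) : ‖ee x‖ = 1 := by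
  unfold ee; exact Complex.norm_exp_ofReal_mul_I _

theorem ee_add (x y : ℝ) : ee (x + y) = ee x * ee y := by
  unfold ee; rw [← Complex.exp_add]; congr 1; push_cast; ring

theorem ee_zero : ee 0 = 1 := by simp [ee]

theorem contDiff_ee {n : WithTop ℕ∞} : ContDiff ℝ n ee := by
  unfold ee
  refine ContDiff.cexp (ContDiff.mul ?_ contDiff_const)
  exact Complex.ofRealCLM.contDiff.comp (contDiff_const.mul contDiff_id)

theorem continuous_ee : Continuous ee := (contDiff_ee (n := 0)).continuous

theorem hasDerivAt_ee (x : ℝ) : HasDerivAt ee (2 * Real.pi * Complex.I * ee x) x := by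
  have h1 : HasDerivAt (fun x : ℝ => (((2 * Real.pi * x : ℝ) : ℂ) * Complex.I))
      (2 * Real.pi * Complex.I) x := by
    have := (((hasDerivAt_id x).const_mul (2 * Real.pi)).ofReal_comp).mul_const Complex.I
    simpa using this
  have := h1.cexp
  unfold ee
  convert this using 1
  ring

theorem iteratedDeriv_ee (n : ℕ) :
    iteratedDeriv n ee = fun x => (2 * Real.pi * Complex.I) ^ n * ee x := by
  induction n with
  | zero => simp
  | succ n ih =>
    rw [iteratedDeriv_succ, ih]
    ext x
    rw [((hasDerivAt_ee x).const_mul _).deriv]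
    ring

theorem norm_iteratedFDeriv_ee (n : ℕ) (x : ℝ) :
    ‖iteratedFDeriv ℝ n ee x‖ = (2 * Real.pi) ^ n := by
  rw [norm_iteratedFDeriv_eq_norm_iteratedDeriv, iteratedDeriv_ee]
  simp [norm_ee, abs_of_pos Real.pi_pos]

section osc
variable {E : Type} [NormedAddCommGroup E] [InnerProductSpace ℝ E] [FiniteDimensional ℝ E]
  [MeasurableSpace E] [BorelSpace E]

/-- The dominating function for the `p`-th derivative. -/
def domB (γ : SchwartzMap E ℂ) (C0 : ℝ) (q p : ℕ) (ζ : E) : ℝ :=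
  ∑ i ∈ Finset.range (p + 1), ((p.choose i : ℝ) * (i.factorial * (2 * Real.pi) ^ p * C0 ^ i)) *
    ((1 + ‖ζ‖) ^ (q * i) * ‖iteratedFDeriv ℝ (p - i) γ ζ‖)

theorem integrable_one_add_pow_mul (γ : SchwartzMap E ℂ) (k n : ℕ) :
    Integrable (fun ζ : E => (1 + ‖ζ‖) ^ k * ‖iteratedFDeriv ℝ n γ ζ‖) := by
  simp_rw [add_comm (1 : ℝ), add_pow, Finset.sum_mul]
  refine integrable_finsetSum _ fun i _ => ?_
  have := (γ.integrable_pow_mul_iteratedFDeriv volume i n).const_mul (k.choose i : ℝ)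
  refine this.congr (Filter.Eventually.of_forall fun x => ?_)
  simp only [one_pow]; ring

theorem integrable_domB (γ : SchwartzMap E ℂ) (C0 : ℝ) (q p : ℕ) : Integrable (domB γ C0 q p) :=
  integrable_finsetSum _ fun _ _ => (integrable_one_add_pow_mul γ _ _).const_mul _

theorem norm_iteratedFDeriv_osc_le (γ : SchwartzMap E ℂ) {C0 κ : ℝ} (hC0 : 1 ≤ C0) (hκ : 1 ≤ κ)
    (q N : ℕ) {ψ : E → ℝ} (hψ : ContDiff ℝ N ψ)
    (hb : ∀ ζ, ∀ i, 1 ≤ i → i ≤ N → ‖iteratedFDeriv ℝ i ψ ζ‖ ≤ (C0 * κ * (1 + ‖ζ‖) ^ q) ^ i)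
    (p : ℕ) (hp : p ≤ N) (ζ : E) :
    ‖iteratedFDeriv ℝ p (fun z => ee (ψ z) * γ z) ζ‖ ≤ κ ^ p * domB γ C0 q p ζ := by
  have hpN : (p : WithTop ℕ∞) ≤ N := by exact_mod_cast hp
  have h1 : ContDiff ℝ N (fun z => ee (ψ z)) := contDiff_ee.comp hψ
  refine (norm_iteratedFDeriv_mul_le h1 (γ.smooth N) ζ hpN).trans ?_
  unfold domB
  rw [Finset.mul_sum]
  refine Finset.sum_le_sum fun i hi => ?_
  have hip : i ≤ p := by have := Finset.mem_range.mp hi; omega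
  have h2 : ‖iteratedFDeriv ℝ i (fun z => ee (ψ z)) ζ‖ ≤
      i.factorial * (2 * Real.pi) ^ p * (C0 * κ * (1 + ‖ζ‖) ^ q) ^ i := by
    have hiN : (i : WithTop ℕ∞) ≤ N := by exact_mod_cast hip.trans hp
    refine norm_iteratedFDeriv_comp_le (g := ee) (f := ψ) contDiff_ee hψ hiN ζ ?_ ?_
    · intro j hj
      rw [norm_iteratedFDeriv_ee]
      exact pow_le_pow_right₀ (by linarith [Real.pi_gt_three]) (hj.trans hip)
    · intro j hj1 hj2
      exact hb ζ j hj1 (hj2.trans (hip.trans hp))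
  have hκ0 : 0 ≤ κ := by linarith
  calc _ ≤ (p.choose i : ℝ) * (i.factorial * (2 * Real.pi) ^ p * (C0 * κ * (1 + ‖ζ‖) ^ q) ^ i) *
        ‖iteratedFDeriv ℝ (p - i) γ ζ‖ := by gcongr
    _ = κ ^ i * (((p.choose i : ℝ) * (i.factorial * (2 * Real.pi) ^ p * C0 ^ i)) *
        ((1 + ‖ζ‖) ^ (q * i) * ‖iteratedFDeriv ℝ (p - i) γ ζ‖)) := by
      rw [mul_pow, mul_pow, ← pow_mul]; ring
    _ ≤ _ := by
      have : 0 ≤ C0 := by linarith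
      gcongr

open scoped FourierTransform in
theorem fourier_osc_le (γ : SchwartzMap E ℂ) {C0 : ℝ} (hC0 : 1 ≤ C0) (q N : ℕ) :
    ∃ C : ℝ, 0 ≤ C ∧ ∀ κ : ℝ, 1 ≤ κ → ∀ ψ : E → ℝ, ContDiff ℝ N ψ →
      (∀ ζ, ∀ i, 1 ≤ i → i ≤ N → ‖iteratedFDeriv ℝ i ψ ζ‖ ≤ (C0 * κ * (1 + ‖ζ‖) ^ q) ^ i) →
      ∀ w : E, ‖𝓕 (fun z => ee (ψ z) * γ z) w‖ * (1 + ‖w‖ / κ) ^ N ≤ C := by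
  set S : ℝ := ∑ p ∈ Finset.range (N + 1), ∫ ζ, |domB γ C0 q p ζ| with hS
  have hS0 : 0 ≤ S := Finset.sum_nonneg fun p _ => integral_nonneg fun _ => abs_nonneg _
  refine ⟨2 ^ N * (S + 2 ^ N * S), by positivity, ?_⟩
  intro κ hκ ψ hψ hb w
  have hκ0 : 0 < κ := by linarith
  set f : E → ℂ := fun z => ee (ψ z) * γ z with hf
  have hfN : ContDiff ℝ N f := (contDiff_ee.comp hψ).mul (γ.smooth N)
  have hbd := norm_iteratedFDeriv_osc_le γ hC0 hκ q N hψ hb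
  have hintg : ∀ p ≤ N, Integrable (fun v => ‖iteratedFDeriv ℝ p f v‖) := by
    intro p hp
    refine ((integrable_domB γ C0 q p).const_mul (κ ^ p)).mono' ?_ ?_
    · exact (hfN.continuous_iteratedFDeriv (by exact_mod_cast hp)).norm.aestronglyMeasurable
    · refine Filter.Eventually.of_forall fun x => ?_
      rw [norm_norm]; exact hbd p hp x
  have hle : ∀ p ≤ N, ∫ v, ‖iteratedFDeriv ℝ p f v‖ ≤ κ ^ p * ∫ ζ, |domB γ C0 q p ζ| := by
    intro p hp
    rw [← integral_const_mul]
    refine integral_mono (hintg p hp) ((integrable_domB γ C0 q p).abs.const_mul _) fun x => ?_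
    refine (hbd p hp x).trans ?_
    gcongr
    exact le_abs_self _
  have key : ∀ n ≤ N, ‖w‖ ^ n * ‖𝓕 f w‖ ≤ 2 ^ n * (κ ^ n * S) := by
    intro n hn
    have := Real.pow_mul_norm_iteratedFDeriv_fourier_le (f := f) (K := 0) (N := N)
      (by exact_mod_cast hfN) (k := 0) (n := n) (by
        intro k n hk hn
        have hk0 : k = 0 := by simpa using hk
        subst hk0
        simpa using hintg n (by exact_mod_cast hn)) (by simp) (by exact_mod_cast hn) w
    simp only [norm_iteratedFDeriv_zero, pow_zero, Nat.cast_zero, mul_zero, zero_add, one_mul,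
      Finset.range_one, Finset.singleton_product, Finset.sum_map,
      Function.Embedding.coeFn_mk] at this
    refine this.trans ?_
    gcongr
    rw [hS, Finset.mul_sum]
    calc _ ≤ ∑ p ∈ Finset.range (n + 1), κ ^ n * ∫ ζ, |domB γ C0 q p ζ| := by
          refine Finset.sum_le_sum fun p hp => ?_
          have hpn : p ≤ n := by have := Finset.mem_range.mp hp; omega
          refine (hle p (hpn.trans hn)).trans ?_
          have : 0 ≤ ∫ ζ, |domB γ C0 q p ζ| := integral_nonneg fun _ => abs_nonneg _
          gcongr
      _ ≤ _ := by
          refine Finset.sum_le_sum_of_subset_of_nonneg ?_ ?_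
          · intro p hp
            simp only [Finset.mem_range] at hp ⊢; omega
          · intro p _ _
            have : 0 ≤ ∫ ζ, |domB γ C0 q p ζ| := integral_nonneg fun _ => abs_nonneg _
            positivity
  have k0 := key 0 (Nat.zero_le _)
  have kN := key N le_rfl
  simp only [pow_zero, one_mul] at k0
  have h1 : (1 + ‖w‖ / κ) ^ N ≤ 2 ^ N * (1 + (‖w‖ / κ) ^ N) := by
    refine (add_pow_le zero_le_one (by positivity) N).trans ?_
    rw [one_pow]
    gcongr
    · norm_num
    · omega
  have h2 : (‖w‖ / κ) ^ N * ‖𝓕 f w‖ ≤ 2 ^ N * S := by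
    rw [div_pow, div_mul_eq_mul_div, div_le_iff₀ (by positivity)]
    linarith
  calc ‖𝓕 f w‖ * (1 + ‖w‖ / κ) ^ N ≤ ‖𝓕 f w‖ * (2 ^ N * (1 + (‖w‖ / κ) ^ N)) := by gcongr
    _ = 2 ^ N * (‖𝓕 f w‖ + (‖w‖ / κ) ^ N * ‖𝓕 f w‖) := by ring
    _ ≤ _ := by gcongr


theorem IsHom.bound_all {F : Type} [NormedAddCommGroup F] [NormedSpace ℝ F] {f : E → F} {s : ℝ}
    (hf : IsHom f s) (N : ℕ) (hN : (N : ℝ) < s) :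
    ∃ M : ℝ, 0 ≤ M ∧ ∀ j ≤ N, ∀ x, ‖iteratedFDeriv ℝ j f x‖ ≤ M * ‖x‖ ^ (s - j) := by
  choose! M hM0 hM using (hf.contDiff N hN).2
  refine ⟨∑ j ∈ Finset.range (N + 1), M j, Finset.sum_nonneg fun j hj => hM0 j ?_, ?_⟩
  · have := Finset.mem_range.mp hj; omega
  · intro j hj x
    refine (hM j hj x).trans ?_
    gcongr
    refine Finset.single_le_sum (f := M) (fun i hi => hM0 i ?_) (Finset.mem_range.mpr (by omega))
    have := Finset.mem_range.mp hi; omega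

theorem phase_bound {μ : E → ℝ} {m : ℝ} (hμ : IsHom μ m) {N : ℕ} (hN2 : 2 ≤ N) (hNm : (N : ℝ) < m) :
    ∃ C0 : ℝ, 1 ≤ C0 ∧ ∃ q : ℕ, ∀ t : ℝ, 0 < t → t ≤ 1 → ∀ ξ ζ : E, ∀ i, 1 ≤ i → i ≤ N →
      ‖iteratedFDeriv ℝ i (fun z => t * (μ (z + ξ) - fderiv ℝ μ ξ z)) ζ‖ ≤
        (C0 * (1 + t * ‖ξ‖ ^ (m - 2)) * (1 + ‖ζ‖) ^ q) ^ i := by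
  obtain ⟨M, hM0, hM⟩ := hμ.bound_all N hNm
  have hcd := (hμ.contDiff N hNm).1
  have hm2 : 0 ≤ m - 2 := by
    have : (2 : ℝ) ≤ N := by exact_mod_cast hN2
    linarith
  refine ⟨1 + M * 2 ^ (m - 2), by have : 0 ≤ M * 2 ^ (m - 2) := by positivity
                                  linarith, ⌈m⌉₊ + 1, ?_⟩
  intro t ht0 ht1 ξ ζ i hi1 hiN
  set κ := 1 + t * ‖ξ‖ ^ (m - 2) with hκ
  have hκ1 : 1 ≤ κ := by
    have : 0 ≤ t * ‖ξ‖ ^ (m - 2) := by positivity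
    linarith
  set P := t * (1 + ‖ξ‖ + ‖ζ‖) ^ (m - 2) with hP
  have hPle : P ≤ 2 ^ (m - 2) * κ * (1 + ‖ζ‖) ^ ⌈m⌉₊ := by
    have a1 : (1 + ‖ξ‖ + ‖ζ‖) ^ (m - 2) ≤ (1 + ‖ξ‖) ^ (m - 2) * (1 + ‖ζ‖) ^ (m - 2) := by
      rw [← Real.mul_rpow (by positivity) (by positivity)]
      refine Real.rpow_le_rpow (by positivity) ?_ hm2
      nlinarith [norm_nonneg ξ, norm_nonneg ζ, mul_nonneg (norm_nonneg ξ) (norm_nonneg ζ)]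
    have a2 : (1 + ‖ξ‖) ^ (m - 2) ≤ 2 ^ (m - 2) * (1 + ‖ξ‖ ^ (m - 2)) := by
      rcases le_total ‖ξ‖ 1 with h | h
      · calc (1 + ‖ξ‖) ^ (m - 2) ≤ 2 ^ (m - 2) :=
              Real.rpow_le_rpow (by positivity) (by linarith) hm2
          _ ≤ _ := le_mul_of_one_le_right (by positivity)
              (by have : 0 ≤ ‖ξ‖ ^ (m - 2) := by positivity
                  linarith)
      · calc (1 + ‖ξ‖) ^ (m - 2) ≤ (2 * ‖ξ‖) ^ (m - 2) :=
              Real.rpow_le_rpow (by positivity) (by linarith) hm2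
          _ = 2 ^ (m - 2) * ‖ξ‖ ^ (m - 2) := Real.mul_rpow (by positivity) (by positivity)
          _ ≤ _ := by gcongr; linarith
    have a3 : (1 + ‖ζ‖) ^ (m - 2) ≤ (1 + ‖ζ‖) ^ ⌈m⌉₊ := by
      rw [← Real.rpow_natCast]
      refine Real.rpow_le_rpow_of_exponent_le (by linarith [norm_nonneg ζ]) ?_
      linarith [Nat.le_ceil m]
    have a4 : t * (1 + ‖ξ‖ ^ (m - 2)) ≤ κ := by rw [hκ]; linarith
    calc P ≤ t * ((2 ^ (m - 2) * (1 + ‖ξ‖ ^ (m - 2))) * (1 + ‖ζ‖) ^ ⌈m⌉₊) := by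
            rw [hP]; gcongr; exact a1.trans (by gcongr)
      _ = 2 ^ (m - 2) * (t * (1 + ‖ξ‖ ^ (m - 2))) * (1 + ‖ζ‖) ^ ⌈m⌉₊ := by ring
      _ ≤ _ := by gcongr
  have hz1 : 1 ≤ 1 + ‖ζ‖ := by linarith [norm_nonneg ζ]
  set X := (1 + M * 2 ^ (m - 2)) * κ * (1 + ‖ζ‖) ^ (⌈m⌉₊ + 1) with hX
  have hX1 : 1 ≤ X := by
    have : 1 ≤ (1 + ‖ζ‖) ^ (⌈m⌉₊ + 1) := one_le_pow₀ hz1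
    have h3 : 1 ≤ 1 + M * 2 ^ (m - 2) := by
      have : 0 ≤ M * 2 ^ (m - 2) := by positivity
      linarith
    exact one_le_mul_of_one_le_of_one_le (one_le_mul_of_one_le_of_one_le h3 hκ1) this
  have hXM : M * P * (1 + ‖ζ‖) ≤ X := by
    calc M * P * (1 + ‖ζ‖) ≤ M * (2 ^ (m - 2) * κ * (1 + ‖ζ‖) ^ ⌈m⌉₊) * (1 + ‖ζ‖) := by gcongr
      _ = M * 2 ^ (m - 2) * κ * (1 + ‖ζ‖) ^ (⌈m⌉₊ + 1) := by rw [pow_succ]; ring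
      _ ≤ X := by rw [hX]; gcongr; linarith
  refine le_trans ?_ (le_self_pow₀ hX1 (by omega : i ≠ 0))
  refine le_trans ?_ hXM
  have hN2' : (2 : WithTop ℕ∞) ≤ N := by exact_mod_cast hN2
  have hdμ : Differentiable ℝ μ := hcd.differentiable (by
    have : (N : WithTop ℕ∞) ≠ 0 := by exact_mod_cast (by omega : N ≠ 0)
    exact this)
  have hf1 : ContDiff ℝ 1 (fderiv ℝ μ) := hcd.fderiv_right (by norm_num; exact hN2)
  have hψ1 : fderiv ℝ (fun z => t * (μ (z + ξ) - fderiv ℝ μ ξ z)) =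
      fun z => t • (fderiv ℝ μ (z + ξ) - fderiv ℝ μ ξ) := by
    ext1 z
    have h1 : HasFDerivAt (fun z => μ (z + ξ)) (fderiv ℝ μ (z + ξ)) z := by
      have := (hdμ (z + ξ)).hasFDerivAt.comp z ((hasFDerivAt_id z).add_const ξ)
      simpa [Function.comp_def] using this
    exact ((h1.sub (fderiv ℝ μ ξ).hasFDerivAt).const_mul t).fderiv
  obtain ⟨j, rfl⟩ : ∃ j, i = j + 1 := ⟨i - 1, by omega⟩
  rw [← norm_iteratedFDeriv_fderiv, hψ1]
  have hDD : ∀ z : E, ‖fderiv ℝ (fderiv ℝ μ) z‖ ≤ M * ‖z‖ ^ (m - 2) := by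
    intro z
    have := hM 2 hN2 z
    rw [← norm_iteratedFDeriv_fderiv, ← norm_iteratedFDeriv_fderiv, norm_iteratedFDeriv_zero] at this
    exact_mod_cast this
  cases j with
  | zero =>
    rw [norm_iteratedFDeriv_zero, norm_smul, Real.norm_of_nonneg ht0.le]
    have hmv : ‖fderiv ℝ μ (ζ + ξ) - fderiv ℝ μ ξ‖ ≤
        (M * (1 + ‖ξ‖ + ‖ζ‖) ^ (m - 2)) * ‖(ζ + ξ) - ξ‖ := by
      refine (convex_closedBall (0 : E) (‖ξ‖ + ‖ζ‖)).norm_image_sub_le_of_norm_fderiv_le (𝕜 := ℝ)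
        (fun z _ => hf1.differentiable (by norm_num) z) ?_ ?_ ?_
      · intro z hz
        refine (hDD z).trans ?_
        gcongr
        have : ‖z‖ ≤ ‖ξ‖ + ‖ζ‖ := by simpa using hz
        linarith
      · simp
      · rw [mem_closedBall_zero_iff]
        linarith [norm_add_le ζ ξ]
    rw [add_sub_cancel_right] at hmv
    calc t * ‖fderiv ℝ μ (ζ + ξ) - fderiv ℝ μ ξ‖
        ≤ t * (M * (1 + ‖ξ‖ + ‖ζ‖) ^ (m - 2) * ‖ζ‖) := by gcongr
      _ = M * P * ‖ζ‖ := by rw [hP]; ring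
      _ ≤ _ := by
        have : 0 ≤ M * P := by positivity
        nlinarith
  | succ j =>
    have hψ2 : fderiv ℝ (fun z => t • (fderiv ℝ μ (z + ξ) - fderiv ℝ μ ξ)) =
        fun z => t • fderiv ℝ (fderiv ℝ μ) (z + ξ) := by
      ext1 z
      have h1 : HasFDerivAt (fun z => fderiv ℝ μ (z + ξ)) (fderiv ℝ (fderiv ℝ μ) (z + ξ)) z := by
        have := ((hf1.differentiable (by norm_num)) (z + ξ)).hasFDerivAt.comp z
          ((hasFDerivAt_id z).add_const ξ)
        simpa [Function.comp_def] using this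
      exact ((h1.sub_const _).const_smul t).fderiv
    rw [← norm_iteratedFDeriv_fderiv, hψ2]
    have hcdj : ContDiff ℝ j (fderiv ℝ (fderiv ℝ μ)) := by
      have e1 : ContDiff ℝ ((j : ℕ) + 1 : WithTop ℕ∞) (fderiv ℝ μ) :=
        hcd.fderiv_right (by exact_mod_cast hiN)
      exact e1.fderiv_right le_rfl
    rw [iteratedFDeriv_const_smul_apply' (a := t) (f := fun z => fderiv ℝ (fderiv ℝ μ) (z + ξ))
      (hcdj.comp (contDiff_id.add contDiff_const)).contDiffAt, norm_smul,
      Real.norm_of_nonneg ht0.le, iteratedFDeriv_comp_add_right, norm_iteratedFDeriv_fderiv,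
      norm_iteratedFDeriv_fderiv]
    have hge : (0 : ℝ) ≤ m - ((j + 1 + 1 : ℕ) : ℝ) := by
      have : ((j + 1 + 1 : ℕ) : ℝ) ≤ N := by exact_mod_cast hiN
      linarith
    calc t * ‖iteratedFDeriv ℝ (j + 1 + 1) μ (ζ + ξ)‖
        ≤ t * (M * ‖ζ + ξ‖ ^ (m - (j + 1 + 1 : ℕ))) := by gcongr; exact hM _ hiN _
      _ ≤ t * (M * (1 + ‖ξ‖ + ‖ζ‖) ^ (m - 2)) := by
        gcongr
        calc ‖ζ + ξ‖ ^ (m - (j + 1 + 1 : ℕ)) ≤ (1 + ‖ξ‖ + ‖ζ‖) ^ (m - (j + 1 + 1 : ℕ)) :=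
              Real.rpow_le_rpow (norm_nonneg _) (by linarith [norm_add_le ζ ξ]) hge
          _ ≤ _ := by
            refine Real.rpow_le_rpow_of_exponent_le (by linarith [norm_nonneg ζ, norm_nonneg ξ]) ?_
            push_cast; linarith [Nat.cast_nonneg (α := ℝ) j]
      _ = M * P := by rw [hP]; ring
      _ ≤ _ := le_mul_of_one_le_right (by positivity) hz1

open scoped FourierTransform in
theorem osc_bound {μ : E → ℝ} {m : ℝ} (hμ : IsHom μ m) {N : ℕ} (hN2 : 2 ≤ N) (hNm : (N : ℝ) < m)
    (γ : SchwartzMap E ℂ) :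
    ∃ C : ℝ, 0 ≤ C ∧ ∀ t : ℝ, 0 < t → t ≤ 1 → ∀ x ξ : E,
      ‖∫ η, ee (t * μ η + ⟪x, η⟫) * γ (η - ξ)‖ *
        (1 + ‖innerSL ℝ x + t • fderiv ℝ μ ξ‖ / (1 + t * ‖ξ‖ ^ (m - 2))) ^ N ≤ C := by
  obtain ⟨C0, hC0, q, hph⟩ := phase_bound hμ hN2 hNm
  obtain ⟨C, hC, hF⟩ := fourier_osc_le γ hC0 q N
  have hcd := (hμ.contDiff N hNm).1
  refine ⟨C, hC, fun t ht0 ht1 x ξ => ?_⟩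
  set ℓ := innerSL ℝ x + t • fderiv ℝ μ ξ with hℓ
  set v : E := (InnerProductSpace.toDual ℝ E).symm ℓ with hv
  have hvn : ‖-v‖ = ‖ℓ‖ := by rw [norm_neg, hv, LinearIsometryEquiv.norm_map]
  have hvi : ∀ z, ⟪v, z⟫ = ℓ z := fun z => by
    rw [hv, InnerProductSpace.toDual_symm_apply]
  set ψ : E → ℝ := fun z => t * (μ (z + ξ) - fderiv ℝ μ ξ z) with hψ
  have hψc : ContDiff ℝ N ψ := by
    refine contDiff_const.mul (ContDiff.sub ?_ (fderiv ℝ μ ξ).contDiff)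
    exact hcd.comp (contDiff_id.add contDiff_const)
  have h1 := hF (1 + t * ‖ξ‖ ^ (m - 2)) (by
    have : 0 ≤ t * ‖ξ‖ ^ (m - 2) := by positivity
    linarith) ψ hψc (fun ζ i hi1 hi2 => hph t ht0 ht1 ξ ζ i hi1 hi2) (-v)
  rw [hvn] at h1
  convert h1 using 2
  have e : ∫ η, ee (t * μ η + ⟪x, η⟫) * γ (η - ξ) =
      ee ⟪x, ξ⟫ * 𝓕 (fun z => ee (ψ z) * γ z) (-v) := by
    rw [Real.fourier_eq', ← integral_const_mul,
      ← integral_add_right_eq_self (fun η => ee (t * μ η + ⟪x, η⟫) * γ (η - ξ)) ξ]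
    refine integral_congr_ae (Filter.Eventually.of_forall fun z => ?_)
    simp only [add_sub_cancel_right, smul_eq_mul]
    have e2 : Complex.exp (((-2 * Real.pi * ⟪z, -v⟫ : ℝ) : ℂ) * Complex.I) = ee (ℓ z) := by
      rw [← hvi z, ee]; congr 3
      rw [inner_neg_right, real_inner_comm]; ring
    rw [e2, ← mul_assoc, ← mul_assoc, ← ee_add, ← ee_add]
    congr 2
    rw [hψ, hℓ, inner_add_right]
    simp only [add_apply, innerSL_apply_apply, smul_apply,
      smul_eq_mul]
    ring
  rw [e, norm_mul, norm_ee, one_mul]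

end osc

end PartSec2

section PartSec3

set_option linter.unusedSectionVars false
/-! ## Part 3: geometry of the gradient map -/
section geom
variable {E : Type} [NormedAddCommGroup E] [InnerProductSpace ℝ E] [FiniteDimensional ℝ E]
  [MeasurableSpace E] [BorelSpace E] {F : Type} [NormedAddCommGroup F] [NormedSpace ℝ F]

theorem inj_of_sphere {p : E → F} {r : ℝ} (hp : IsHom p r) (hr : 1 < r)
    (hinj : ∀ x : E, ‖x‖ = 1 → Function.Injective (fderiv ℝ p x)) (z : E) (hz : z ≠ 0) :
    Function.Injective (fderiv ℝ p z) := by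
  have hn : 0 < ‖z‖ := norm_pos_iff.mpr hz
  have hz' : ‖z‖⁻¹ • z ≠ 0 := smul_ne_zero (inv_ne_zero hn.ne') hz
  have e : fderiv ℝ p z = ‖z‖ ^ (r - 1) • fderiv ℝ p (‖z‖⁻¹ • z) := by
    rw [← (hp.fderiv hr).2.1 _ hn _ hz', smul_smul, mul_inv_cancel₀ hn.ne', one_smul]
  have h1 := hinj (‖z‖⁻¹ • z) (by simp [norm_smul, hn.ne'])
  intro a b hab
  rw [e] at hab
  simp only [smul_apply] at hab
  exact h1 (smul_right_injective F (Real.rpow_pos_of_pos hn _).ne' hab)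

theorem euler {p : E → F} {r : ℝ} (hp : IsHom p r) (z : E) (hz : z ≠ 0) :
    fderiv ℝ p z z = r • p z := by
  have hd : DifferentiableAt ℝ p z :=
    (hp.1.contDiffAt (isOpen_ne.mem_nhds hz)).differentiableAt (by simp)
  have h1 : HasDerivAt (fun c : ℝ => p (c • z)) (fderiv ℝ p z z) 1 := by
    have h2 : HasDerivAt (fun c : ℝ => c • z) z 1 := by
      simpa using (hasDerivAt_id (1 : ℝ)).smul_const z
    have hd' : HasFDerivAt p (fderiv ℝ p z) ((1 : ℝ) • z) := by
      rw [one_smul]; exact hd.hasFDerivAt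
    exact hd'.comp_hasDerivAt (1 : ℝ) h2
  have h3 : HasDerivAt (fun c : ℝ => p (c • z)) (r • p z) 1 := by
    have h4 : HasDerivAt (fun c : ℝ => c ^ r • p z) (r • p z) 1 := by
      have := (Real.hasDerivAt_rpow_const (x := 1) (p := r) (Or.inl one_ne_zero)).smul_const (p z)
      simpa using this
    refine h4.congr_of_eventuallyEq ?_
    filter_upwards [lt_mem_nhds (zero_lt_one (α := ℝ))] with c hc
    exact hp.2.1 c hc z hz
  exact h1.unique h3

theorem lower_bound [Nontrivial E] {p : E → F} {r : ℝ} (hp : IsHom p r) (hr : 1 < r)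
    (hinj : ∀ x : E, ‖x‖ = 1 → Function.Injective (fderiv ℝ p x)) :
    ∃ a : ℝ, 0 < a ∧ ∀ z, a * ‖z‖ ^ r ≤ ‖p z‖ := by
  have hne : (Metric.sphere (0 : E) 1).Nonempty := NormedSpace.sphere_nonempty.mpr zero_le_one
  obtain ⟨z0, hz0, hmin⟩ := (isCompact_sphere (0 : E) 1).exists_isMinOn hne
    (f := fun z => ‖p z‖) (hp.continuous (by linarith)).norm.continuousOn
  have hz01 : ‖z0‖ = 1 := by simpa using hz0
  have hz00 : z0 ≠ 0 := by rintro rfl; simp at hz01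
  have hp0 : p z0 ≠ 0 := by
    intro h
    have h1 := euler hp z0 hz00
    rw [h, smul_zero] at h1
    exact hz00 (hinj z0 hz01 (by rw [h1, map_zero]))
  refine ⟨‖p z0‖, norm_pos_iff.mpr hp0, fun z => ?_⟩
  by_cases hz : z = 0
  · subst hz; rw [norm_zero, Real.zero_rpow (by linarith), mul_zero]; exact norm_nonneg _
  have hn : 0 < ‖z‖ := norm_pos_iff.mpr hz
  have hz' : ‖z‖⁻¹ • z ≠ 0 := smul_ne_zero (inv_ne_zero hn.ne') hz
  have e : p z = ‖z‖ ^ r • p (‖z‖⁻¹ • z) := by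
    rw [← hp.2.1 _ hn _ hz', smul_smul, mul_inv_cancel₀ hn.ne', one_smul]
  rw [e, norm_smul, Real.norm_of_nonneg (by positivity), mul_comm]
  gcongr
  exact hmin (by simp [norm_smul, hn.ne'])

theorem local_antilip {p : E → F} {r : ℝ} (hp : IsHom p r) (hr : 1 < r)
    (hinj : ∀ x : E, ‖x‖ = 1 → Function.Injective (fderiv ℝ p x)) (z0 : E) (hz0 : z0 ≠ 0) :
    ∃ ε : ℝ, 0 < ε ∧ ∃ c : ℝ, 0 < c ∧ ∀ z ∈ Metric.closedBall z0 ε, ∀ z' ∈ Metric.closedBall z0 ε,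
      c * ‖z - z'‖ ≤ ‖p z - p z'‖ := by
  have h1 : HasStrictFDerivAt p (fderiv ℝ p z0) z0 :=
    (hp.1.contDiffAt (isOpen_ne.mem_nhds hz0)).hasStrictFDerivAt (by simp)
  obtain ⟨K, hK0, hK⟩ := LinearMap.exists_antilipschitzWith (fderiv ℝ p z0 : E →ₗ[ℝ] F)
    (LinearMap.ker_eq_bot.mpr (inj_of_sphere hp hr hinj z0 hz0))
  have hK0' : (0 : ℝ) < K := hK0
  have hD : ∀ v, (K : ℝ)⁻¹ * ‖v‖ ≤ ‖fderiv ℝ p z0 v‖ := by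
    intro v
    have := hK.le_mul_dist v 0
    rw [map_zero, dist_zero_right, dist_zero_right] at this
    rw [inv_mul_le_iff₀ hK0']
    exact this
  have h2 := (Asymptotics.isLittleO_iff.mp h1.isLittleO) (c := (K : ℝ)⁻¹ / 2) (by positivity)
  rw [nhds_prod_eq] at h2
  obtain ⟨t, ht, h3⟩ := Filter.mem_prod_same_iff.mp h2
  obtain ⟨ε, hε, hεt⟩ := Metric.nhds_basis_closedBall.mem_iff.mp ht
  refine ⟨ε, hε, (K : ℝ)⁻¹ / 2, by positivity, fun z hz z' hz' => ?_⟩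
  have h4 := h3 (Set.mk_mem_prod (hεt hz) (hεt hz'))
  have h5 := hD (z - z')
  have h6 := norm_sub_norm_le (fderiv ℝ p z0 (z - z')) (p z - p z')
  rw [norm_sub_rev (fderiv ℝ p z0 (z - z'))] at h6
  simp only [Set.mem_ofPred_eq] at h4
  linarith

/-- `((1+c‖ζ‖)^N)⁻¹` is integrable for `N > dim`. -/
theorem lintegral_decay_lt_top {N : ℕ} (hN : Module.finrank ℝ E < N) {c : ℝ} (hc : 0 < c) :
    ∫⁻ ζ : E, ENNReal.ofReal (((1 + c * ‖ζ‖) ^ N)⁻¹) < ⊤ := by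
  have h1 := finite_integral_one_add_norm (E := E) (μ := volume) (r := N) (by exact_mod_cast hN)
  set c' := min c 1 with hc'
  have hc0 : 0 < c' := lt_min hc one_pos
  refine lt_of_le_of_lt (b := ∫⁻ x : E, ENNReal.ofReal ((c' ^ N)⁻¹) *
    ENNReal.ofReal ((1 + ‖x‖) ^ (-(N : ℝ)))) ?_ ?_
  · refine lintegral_mono fun x => ?_
    simp only
    rw [← ENNReal.ofReal_mul (by positivity)]
    refine ENNReal.ofReal_le_ofReal ?_
    rw [Real.rpow_neg (by positivity), Real.rpow_natCast, ← mul_inv, ← mul_pow]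
    gcongr
    rw [mul_add, mul_one]
    gcongr
    · exact min_le_right _ _
    · exact min_le_left _ _
  · rw [lintegral_const_mul' _ _ ENNReal.ofReal_ne_top]
    exact ENNReal.mul_lt_top ENNReal.ofReal_lt_top h1

theorem geom_pointwise [Nontrivial E] {p : E → F} {r : ℝ} (hp : IsHom p r) (hr : 1 < r)
    (hinj : ∀ x : E, ‖x‖ = 1 → Function.Injective (fderiv ℝ p x)) :
    ∃ c : ℝ, 0 < c ∧ ∃ S : Finset E, ∀ ℓ : F, ∃ v : E → E, ∀ ζ : E, 1 ≤ ‖ζ‖ →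
      c * ‖ζ‖ ≤ ‖ℓ + p ζ‖ / (1 + ‖ζ‖ ^ (r - 1)) ∨
      ∃ z0 ∈ S, c * ‖ζ - v z0‖ ≤ ‖ℓ + p ζ‖ / (1 + ‖ζ‖ ^ (r - 1)) := by
  obtain ⟨a, ha, hlow⟩ := lower_bound hp hr hinj
  obtain ⟨b', hb'0, hb'⟩ := hp.bound
  set b := b' + 1 with hb
  have hb0 : 0 < b := by linarith
  have hup : ∀ z, ‖p z‖ ≤ b * ‖z‖ ^ r := fun z => (hb' z).trans (by gcongr; linarith)
  set A : Set E := {z | 1 / (2 * b) ≤ ‖z‖ ^ r ∧ ‖z‖ ^ r ≤ 2 / a} with hA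
  set k : ℝ := (2 / a) ^ (1 / r) with hk
  have hk0 : 0 < k := by positivity
  have hAk : ∀ z ∈ A, ‖z‖ ≤ k := by
    intro z hz
    have := Real.rpow_le_rpow (by positivity) hz.2 (show 0 ≤ 1 / r by positivity)
    rwa [← Real.rpow_mul (norm_nonneg _), mul_one_div_cancel (by linarith), Real.rpow_one] at this
  have hcr : Continuous fun z : E => ‖z‖ ^ r :=
    continuous_norm.rpow_const (fun _ => Or.inr (by linarith))
  have hAc : IsCompact A := by
    refine (isCompact_closedBall (0 : E) k).of_isClosed_subset ?_ ?_
    · exact (isClosed_le continuous_const hcr).inter (isClosed_le hcr continuous_const)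
    · intro z hz; simpa using hAk z hz
  have hA0 : ∀ z ∈ A, z ≠ 0 := by
    rintro z hz rfl
    have h1 := hz.1
    rw [norm_zero, Real.zero_rpow (by linarith)] at h1
    have : 0 < 1 / (2 * b) := by positivity
    linarith
  choose! ε hε cc hcc hanti using local_antilip hp hr hinj
  obtain ⟨S, hSA, hS⟩ := hAc.elim_nhds_subcover (fun z => Metric.closedBall z (ε z))
    (fun z hz => Metric.closedBall_mem_nhds z (hε z (hA0 z hz)))
  -- uniform constant
  obtain ⟨c1, hc10, hc1⟩ : ∃ c1 : ℝ, 0 < c1 ∧ ∀ z ∈ S, c1 ≤ cc z := by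
    by_cases hSn : S.Nonempty
    · obtain ⟨z, hz, hmin⟩ := S.exists_min_image cc hSn
      exact ⟨cc z, hcc z (hA0 z (hSA z hz)), hmin⟩
    · rw [Finset.not_nonempty_iff_eq_empty] at hSn
      exact ⟨1, one_pos, by simp [hSn]⟩
  set c := min (min (b / 2) (a / 4)) (c1 / (4 * k ^ (r - 1))) with hc
  have hc0 : 0 < c := by positivity
  refine ⟨c, hc0, S, fun ℓ => ?_⟩
  set R : ℝ := ‖ℓ‖ ^ (1 / r) with hR
  have hR0 : 0 ≤ R := by positivity
  have hRr : R ^ r = ‖ℓ‖ := by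
    rw [hR, ← Real.rpow_mul (norm_nonneg _), one_div_mul_cancel (by linarith), Real.rpow_one]
  have hex : ∀ z0 : E, ∃ v : E, z0 ∈ S → v ∈ Metric.closedBall z0 (ε z0) ∧
      ∀ z ∈ Metric.closedBall z0 (ε z0), ‖ℓ + p (R • v)‖ ≤ ‖ℓ + p (R • z)‖ := by
    intro z0
    by_cases hz0 : z0 ∈ S
    · have hpos := hε z0 (hA0 z0 (hSA z0 hz0))
      obtain ⟨v, hv, hmin⟩ := (isCompact_closedBall z0 (ε z0)).exists_isMinOn
        ⟨z0, Metric.mem_closedBall_self hpos.le⟩ (f := fun z => ‖ℓ + p (R • z)‖)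
        ((continuous_const.add ((hp.continuous (by linarith)).comp
          (continuous_const_smul R))).norm.continuousOn)
      exact ⟨v, fun _ => ⟨hv, fun z hz => hmin hz⟩⟩
    · exact ⟨0, fun h => absurd h hz0⟩
  choose v hv using hex
  refine ⟨fun z0 => R • v z0, fun ζ hζ => ?_⟩
  have hζ0 : 0 < ‖ζ‖ := by linarith
  have hζne : ζ ≠ 0 := norm_pos_iff.mp hζ0
  have hκ0 : 0 < 1 + ‖ζ‖ ^ (r - 1) := by positivity
  have hκ2 : 1 + ‖ζ‖ ^ (r - 1) ≤ 2 * ‖ζ‖ ^ (r - 1) := by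
    have := Real.one_le_rpow hζ (show 0 ≤ r - 1 by linarith)
    linarith
  have hrr : ‖ζ‖ ^ r = ‖ζ‖ ^ (r - 1) * ‖ζ‖ := by
    rw [Real.rpow_sub_one hζ0.ne']; field_simp
  have case1 : ∀ c2 : ℝ, 2 * c ≤ c2 → c2 * ‖ζ‖ ^ r ≤ ‖ℓ + p ζ‖ →
      c * ‖ζ‖ ≤ ‖ℓ + p ζ‖ / (1 + ‖ζ‖ ^ (r - 1)) := by
    intro c2 h1 h2
    rw [le_div_iff₀ hκ0]
    calc c * ‖ζ‖ * (1 + ‖ζ‖ ^ (r - 1)) ≤ c * ‖ζ‖ * (2 * ‖ζ‖ ^ (r - 1)) := by gcongr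
      _ = 2 * c * ‖ζ‖ ^ r := by rw [hrr]; ring
      _ ≤ c2 * ‖ζ‖ ^ r := by gcongr
      _ ≤ _ := h2
  by_cases hs : 2 * b * ‖ζ‖ ^ r ≤ ‖ℓ‖
  · left
    refine case1 b ?_ ?_
    · have : c ≤ b / 2 := (min_le_left _ _).trans (min_le_left _ _)
      linarith
    · have h1 := norm_sub_norm_le ℓ (-p ζ)
      rw [norm_neg, sub_neg_eq_add] at h1
      linarith [hup ζ]
  by_cases hl : 2 * ‖ℓ‖ ≤ a * ‖ζ‖ ^ r
  · left
    refine case1 (a / 2) ?_ ?_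
    · have : c ≤ a / 4 := (min_le_left _ _).trans (min_le_right _ _)
      linarith
    · have h1 := norm_sub_norm_le (p ζ) (-ℓ)
      rw [norm_neg, sub_neg_eq_add, add_comm] at h1
      linarith [hlow ζ]
  right
  push Not at hs hl
  have hR1 : 0 < R := by
    rcases hR0.eq_or_lt with h | h
    · exfalso
      rw [← h, Real.zero_rpow (by linarith)] at hRr
      rw [← hRr] at hl
      have : 0 ≤ a * ‖ζ‖ ^ r := by positivity
      linarith
    · exact h
  obtain ⟨z, hζz⟩ : ∃ z : E, ζ = R • z :=
    ⟨R⁻¹ • ζ, by rw [smul_smul, mul_inv_cancel₀ hR1.ne', one_smul]⟩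
  have hzr : ‖z‖ ^ r * ‖ℓ‖ = ‖ζ‖ ^ r := by
    rw [hζz, norm_smul, Real.norm_of_nonneg hR0, Real.mul_rpow hR0 (norm_nonneg _), hRr, mul_comm]
  have hℓ0 : 0 < ‖ℓ‖ := by rw [← hRr]; positivity
  have hzA : z ∈ A := by
    constructor
    · rw [div_le_iff₀ (by positivity)]
      rw [← hzr] at hs
      by_contra hcon
      push Not at hcon
      nlinarith
    · rw [le_div_iff₀ ha]
      rw [← hzr] at hl
      by_contra hcon
      push Not at hcon
      nlinarith
  obtain ⟨z0, hz0S, hzz0⟩ := Set.mem_iUnion₂.mp (hS hzA)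
  refine ⟨z0, hz0S, ?_⟩
  obtain ⟨hvb, hvmin⟩ := hv z0 hz0S
  have hz00 := hA0 z0 (hSA z0 hz0S)
  have h1 : c1 * ‖z - v z0‖ ≤ ‖p z - p (v z0)‖ :=
    le_trans (by gcongr; exact hc1 z0 hz0S) (hanti z0 hz00 z hzz0 (v z0) hvb)
  have hps : ∀ y : E, p (R • y) = R ^ r • p y := by
    intro y
    by_cases hy : y = 0
    · subst hy; rw [smul_zero, hp.2.2, smul_zero]
    · exact hp.2.1 R hR1 y hy
  have h2 : ‖p ζ - p (R • v z0)‖ ≤ 2 * ‖ℓ + p ζ‖ := by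
    have e : p ζ - p (R • v z0) = (ℓ + p ζ) - (ℓ + p (R • v z0)) := by abel
    rw [e]
    refine (norm_sub_le _ _).trans ?_
    have := hvmin z hzz0
    rw [← hζz] at this
    linarith
  rw [hζz, hps, hps, ← smul_sub, norm_smul, Real.norm_of_nonneg (by positivity)] at h2
  rw [← hps, ← hζz] at h2
  have h3 : ‖ζ - R • v z0‖ = R * ‖z - v z0‖ := by
    rw [hζz, ← smul_sub, norm_smul, Real.norm_of_nonneg hR0]
  have hRR : R ^ r = R ^ (r - 1) * R := by
    rw [Real.rpow_sub_one hR1.ne']; field_simp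
  have h4 : c1 * R ^ (r - 1) * ‖ζ - R • v z0‖ ≤ 2 * ‖ℓ + p ζ‖ := by
    refine le_trans ?_ h2
    rw [h3, hRR]
    calc c1 * R ^ (r - 1) * (R * ‖z - v z0‖) = R ^ (r - 1) * R * (c1 * ‖z - v z0‖) := by ring
      _ ≤ _ := by gcongr
  have h5 : 1 + ‖ζ‖ ^ (r - 1) ≤ 2 * k ^ (r - 1) * R ^ (r - 1) := by
    refine hκ2.trans ?_
    rw [mul_assoc, ← Real.mul_rpow hk0.le hR0]
    gcongr
    rw [hζz, norm_smul, Real.norm_of_nonneg hR0, mul_comm]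
    gcongr
    exact hAk z hzA
  rw [le_div_iff₀ hκ0]
  have hck : c * (4 * k ^ (r - 1)) ≤ c1 := by
    rw [← le_div_iff₀ (by positivity)]; exact min_le_right _ _
  calc c * ‖ζ - R • v z0‖ * (1 + ‖ζ‖ ^ (r - 1))
      ≤ c * ‖ζ - R • v z0‖ * (2 * k ^ (r - 1) * R ^ (r - 1)) := by gcongr
    _ = (c * (4 * k ^ (r - 1))) * R ^ (r - 1) * ‖ζ - R • v z0‖ / 2 := by ring
    _ ≤ c1 * R ^ (r - 1) * ‖ζ - R • v z0‖ / 2 := by gcongr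
    _ ≤ _ := by linarith

theorem geom_lintegral [Nontrivial E] {p : E → F} {r : ℝ} (hp : IsHom p r) (hr : 1 < r)
    (hinj : ∀ x : E, ‖x‖ = 1 → Function.Injective (fderiv ℝ p x))
    {N : ℕ} (hN : Module.finrank ℝ E < N) :
    ∃ C : ℝ≥0∞, C < ⊤ ∧ ∀ ℓ : F,
      ∫⁻ ζ : E, ENNReal.ofReal (((1 + ‖ℓ + p ζ‖ / (1 + ‖ζ‖ ^ (r - 1))) ^ N)⁻¹) ≤ C := by
  obtain ⟨c, hc, S, h⟩ := geom_pointwise hp hr hinj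
  set J := ∫⁻ ζ : E, ENNReal.ofReal (((1 + c * ‖ζ‖) ^ N)⁻¹) with hJ
  have hJt : J < ⊤ := lintegral_decay_lt_top hN hc
  refine ⟨volume (Metric.ball (0 : E) 1) + (J + S.card * J), ?_, fun ℓ => ?_⟩
  · refine ENNReal.add_lt_top.mpr ⟨measure_ball_lt_top, ENNReal.add_lt_top.mpr ⟨hJt, ?_⟩⟩
    exact ENNReal.mul_lt_top (ENNReal.natCast_lt_top _) hJt
  obtain ⟨v, hv⟩ := h ℓ
  have hmeas : ∀ y : E, Measurable fun ζ : E => ENNReal.ofReal (((1 + c * ‖ζ - y‖) ^ N)⁻¹) := by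
    intro y; fun_prop
  calc ∫⁻ ζ : E, ENNReal.ofReal (((1 + ‖ℓ + p ζ‖ / (1 + ‖ζ‖ ^ (r - 1))) ^ N)⁻¹)
      ≤ ∫⁻ ζ : E, ((Metric.ball (0 : E) 1).indicator 1 ζ +
        (ENNReal.ofReal (((1 + c * ‖ζ - 0‖) ^ N)⁻¹) +
          ∑ z0 ∈ S, ENNReal.ofReal (((1 + c * ‖ζ - v z0‖) ^ N)⁻¹))) := by
        refine lintegral_mono fun ζ => ?_
        simp only
        by_cases h1 : ‖ζ‖ < 1
        · refine le_add_right ?_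
          rw [Set.indicator_of_mem (by simpa using h1), Pi.one_apply]
          rw [ENNReal.ofReal_le_one]
          refine inv_le_one_of_one_le₀ (one_le_pow₀ ?_)
          have : 0 ≤ ‖ℓ + p ζ‖ / (1 + ‖ζ‖ ^ (r - 1)) := by positivity
          linarith
        · push Not at h1
          refine le_add_left ?_
          rcases hv ζ h1 with h2 | ⟨z0, hz0, h2⟩
          · refine le_add_right (ENNReal.ofReal_le_ofReal ?_)
            rw [sub_zero]
            gcongr
          · refine le_add_left (le_trans (ENNReal.ofReal_le_ofReal ?_)
              (Finset.single_le_sum (f := fun z0 => ENNReal.ofReal (((1 + c * ‖ζ - v z0‖) ^ N)⁻¹))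
                (fun _ _ => zero_le) hz0))
            gcongr
    _ = volume (Metric.ball (0 : E) 1) + (J + S.card * J) := by
        rw [lintegral_add_left (measurable_one.indicator measurableSet_ball),
          lintegral_indicator_one measurableSet_ball, lintegral_add_left (hmeas 0),
          lintegral_finsetSum _ (fun z0 _ => hmeas (v z0))]
        have e : ∀ y : E, ∫⁻ ζ : E, ENNReal.ofReal (((1 + c * ‖ζ - y‖) ^ N)⁻¹) = J := fun y =>
          lintegral_sub_right_eq_self (fun ζ : E => ENNReal.ofReal (((1 + c * ‖ζ‖) ^ N)⁻¹)) y
        simp only [e, Finset.sum_const, nsmul_eq_mul]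

theorem geom_lintegral_t [Nontrivial E] {p : E → F} {r : ℝ} (hp : IsHom p r) (hr : 1 < r)
    (hinj : ∀ x : E, ‖x‖ = 1 → Function.Injective (fderiv ℝ p x))
    {N : ℕ} (hN : Module.finrank ℝ E < N) :
    ∃ C : ℝ≥0∞, C < ⊤ ∧ ∀ t : ℝ, 0 < t → t ≤ 1 → ∀ ℓ : F,
      ∫⁻ ζ : E, ENNReal.ofReal (((1 + ‖ℓ + t • p ζ‖ / (1 + t * ‖ζ‖ ^ (r - 1))) ^ N)⁻¹) ≤
        ENNReal.ofReal (t ^ (-(Module.finrank ℝ E / r))) * C := by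
  obtain ⟨C, hC, h⟩ := geom_lintegral hp hr hinj hN
  refine ⟨C, hC, fun t ht0 ht1 ℓ => ?_⟩
  set s : ℝ := t ^ (1 / r) with hs
  have hs0 : 0 < s := by positivity
  have hs1 : s ≤ 1 := Real.rpow_le_one ht0.le ht1 (by positivity)
  have hsr : s ^ r = t := by
    rw [hs, ← Real.rpow_mul ht0.le, one_div_mul_cancel (by linarith), Real.rpow_one]
  set f : E → ℝ≥0∞ := fun ζ =>
    ENNReal.ofReal (((1 + ‖ℓ + p ζ‖ / (1 + ‖ζ‖ ^ (r - 1))) ^ N)⁻¹) with hf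
  have hpc := hp.continuous (by linarith)
  have hfm : Measurable f := by
    have h2 : Measurable fun ζ => ‖ℓ + p ζ‖ := (continuous_const.add hpc).norm.measurable
    fun_prop
  have hmap := Measure.map_addHaar_smul (volume : Measure E) hs0.ne'
  calc _ ≤ ∫⁻ ζ : E, f (s • ζ) := by
        refine lintegral_mono fun ζ => ENNReal.ofReal_le_ofReal ?_
        have e1 : p (s • ζ) = t • p ζ := by
          by_cases hy : ζ = 0
          · subst hy; rw [smul_zero, hp.2.2, smul_zero]
          · rw [hp.2.1 s hs0 ζ hy, hsr]
        have e2 : t * ‖ζ‖ ^ (r - 1) ≤ ‖s • ζ‖ ^ (r - 1) := by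
          rw [norm_smul, Real.norm_of_nonneg hs0.le, Real.mul_rpow hs0.le (norm_nonneg _)]
          gcongr
          calc t = s ^ r := hsr.symm
            _ ≤ s ^ (r - 1) := Real.rpow_le_rpow_of_exponent_ge hs0 hs1 (by linarith)
        rw [e1]
        gcongr
    _ = ∫⁻ ζ, f ζ ∂(Measure.map (s • ·) volume) :=
        (lintegral_map hfm (measurable_const_smul s)).symm
    _ = ENNReal.ofReal (t ^ (-(Module.finrank ℝ E / r))) * ∫⁻ ζ, f ζ := by
        rw [hmap, lintegral_smul_measure, smul_eq_mul]
        congr 2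
        rw [abs_of_pos (by positivity), hs, ← Real.rpow_natCast, ← Real.rpow_mul ht0.le,
          ← Real.rpow_neg ht0.le]
        congr 1; ring
    _ ≤ _ := by gcongr; exact h ℓ
end geom

end PartSec3

section PartSec4

/-! ## Part 4: the kernel estimate -/

/-- The oscillatory integral governing the Gabor transform of the kernel. -/
def oscI {d : ℕ} (μ : EuclideanSpace ℝ (Fin d) → ℝ) (γ : SchwartzMap (EuclideanSpace ℝ (Fin d)) ℂ)
    (t : ℝ) (x ξ : EuclideanSpace ℝ (Fin d)) : ℂ :=
  ∫ η, ee (t * μ η + ⟪x, η⟫) * γ (η - ξ)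

theorem kernel_estimate (d : ℕ) (hd : 1 ≤ d) (m : ℝ) (hmd : 2 * (d : ℝ) < m)
    (μ : EuclideanSpace ℝ (Fin d) → ℝ)
    (hsmooth : ContDiffOn ℝ (⊤ : ℕ∞) μ {x | x ≠ 0})
    (hhom : ∀ c : ℝ, 0 < c → ∀ x : EuclideanSpace ℝ (Fin d), x ≠ 0 →
      μ (c • x) = c ^ m * μ x)
    (hhess : ∀ x : EuclideanSpace ℝ (Fin d), ‖x‖ = 1 →
      Function.Bijective ⇑(fderiv ℝ (fderiv ℝ μ) x))
    (γ : SchwartzMap (EuclideanSpace ℝ (Fin d)) ℂ) :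
    ∃ C : ℝ, 0 ≤ C ∧ ∀ t : ℝ, 0 < t → t ≤ 1 → ∀ x : EuclideanSpace ℝ (Fin d),
      ∫⁻ ξ, ‖oscI μ γ t x ξ‖ₑ ≤ ENNReal.ofReal (C * t ^ (-(d / (m - 1)))) := by
  have hd' : (1 : ℝ) ≤ d := by exact_mod_cast hd
  set μ' : EuclideanSpace ℝ (Fin d) → ℝ := fun x => if x = 0 then 0 else μ x with hμ'
  have hev : ∀ x : EuclideanSpace ℝ (Fin d), x ≠ 0 → μ' =ᶠ[nhds x] μ := by
    intro x hx
    filter_upwards [isOpen_ne.mem_nhds hx] with y hy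
    simp [hμ', show y ≠ 0 from hy]
  have hH : IsHom μ' m := by
    refine ⟨hsmooth.congr fun x hx => by simp [hμ', show x ≠ 0 from hx], fun c hc x hx => ?_, by simp [hμ']⟩
    simp [hμ', hx, hc.ne', hhom c hc x hx]
  have hinj : ∀ x : EuclideanSpace ℝ (Fin d), ‖x‖ = 1 →
      Function.Injective (fderiv ℝ (fderiv ℝ μ') x) := by
    intro x hx
    have hx0 : x ≠ 0 := by rintro rfl; simp at hx
    rw [(hev x hx0).fderiv.fderiv_eq]
    exact (hhess x hx).1
  haveI : Nonempty (Fin d) := ⟨⟨0, hd⟩⟩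
  haveI : Nontrivial (EuclideanSpace ℝ (Fin d)) := inferInstance
  obtain ⟨C1, hC1, h1⟩ := osc_bound hH (N := d + 1) (by omega) (by push_cast; linarith) γ
  obtain ⟨C2, hC2, h2⟩ := geom_lintegral_t (hH.fderiv (by linarith)) (by linarith) hinj
    (N := d + 1) (by simp)
  refine ⟨C1 * C2.toReal, by positivity, fun t ht0 ht1 x => ?_⟩
  have hosc : ∀ ξ, oscI μ γ t x ξ = ∫ η, ee (t * μ' η + ⟪x, η⟫) * γ (η - ξ) := by
    intro ξ
    refine integral_congr_ae ?_
    have : ∀ᵐ η : EuclideanSpace ℝ (Fin d), η ≠ 0 := by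
      simp [ae_iff]
    filter_upwards [this] with η hη
    simp [hμ', hη]
  calc ∫⁻ ξ, ‖oscI μ γ t x ξ‖ₑ
      ≤ ∫⁻ ξ, ENNReal.ofReal C1 * ENNReal.ofReal (((1 + ‖innerSL ℝ x + t • fderiv ℝ μ' ξ‖ /
          (1 + t * ‖ξ‖ ^ (m - 1 - 1))) ^ (d + 1))⁻¹) := by
        refine lintegral_mono fun ξ => ?_
        simp only
        rw [hosc, ← ofReal_norm_eq_enorm, ← ENNReal.ofReal_mul hC1]
        refine ENNReal.ofReal_le_ofReal ?_
        have := h1 t ht0 ht1 x ξ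
        rw [show m - 1 - 1 = m - 2 by ring, ← div_eq_mul_inv, le_div_iff₀ (by positivity)]
        exact this
    _ = ENNReal.ofReal C1 * ∫⁻ ξ, ENNReal.ofReal (((1 + ‖innerSL ℝ x + t • fderiv ℝ μ' ξ‖ /
          (1 + t * ‖ξ‖ ^ (m - 1 - 1))) ^ (d + 1))⁻¹) :=
        lintegral_const_mul' _ _ ENNReal.ofReal_ne_top
    _ ≤ ENNReal.ofReal C1 * (ENNReal.ofReal (t ^ (-(Module.finrank ℝ
          (EuclideanSpace ℝ (Fin d)) / (m - 1)))) * C2) := by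
        gcongr
        exact h2 t ht0 ht1 _
    _ = _ := by
        rw [← ENNReal.ofReal_toReal hC2.ne, ← ENNReal.ofReal_mul (by positivity),
          ← ENNReal.ofReal_mul hC1, ENNReal.toReal_ofReal (by positivity)]
        congr 1
        simp only [finrank_euclideanSpace, Fintype.card_fin]
        ring

end PartSec4

section PartSec5

/-! ## Part 5: Gabor transforms -/

open scoped FourierTransform in
/-- The inverse Fourier transform of the conjugated window. -/
def gamW {d : ℕ} (g : SchwartzMap (EuclideanSpace ℝ (Fin d)) ℂ) :
    SchwartzMap (EuclideanSpace ℝ (Fin d)) ℂ :=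
  𝓕⁻ (SchwartzMap.postcompCLM (𝕜 := ℝ) (Complex.conjCLE : ℂ →L[ℝ] ℂ) g)

section gabor
variable {d : ℕ} (g : SchwartzMap (EuclideanSpace ℝ (Fin d)) ℂ)

theorem gamW_apply (ζ : EuclideanSpace ℝ (Fin d)) :
    gamW g ζ = ∫ y, ee ⟪ζ, y⟫ * (starRingEnd ℂ) (g y) := by
  unfold gamW
  rw [SchwartzMap.fourierInv_coe, Real.fourierInv_eq']
  refine integral_congr_ae (Filter.Eventually.of_forall fun y => ?_)
  simp only [SchwartzMap.postcompCLM_apply, smul_eq_mul, ee]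
  rw [real_inner_comm]
  rfl

theorem ee_neg_mul (x : ℝ) : ee (-x) * ee x = 1 := by rw [← ee_add]; simp [ee_zero]

theorem gaborT_eq (v : EuclideanSpace ℝ (Fin d) → ℂ) (x ξ : EuclideanSpace ℝ (Fin d)) :
    gaborT d g v x ξ = ∫ y, ee (-⟪ξ, y⟫) * v y * (starRingEnd ℂ) (g (y - x)) := by
  unfold gaborT ee
  refine integral_congr_ae (Filter.Eventually.of_forall fun y => ?_)
  simp only
  congr 3
  push_cast; ring

theorem gamW_shift (x ζ : EuclideanSpace ℝ (Fin d)) :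
    ∫ y, ee ⟪ζ, y⟫ * (starRingEnd ℂ) (g (y - x)) = ee ⟪ζ, x⟫ * gamW g ζ := by
  rw [gamW_apply, ← integral_const_mul,
    ← integral_sub_right_eq_self (fun y => ee ⟪ζ, x⟫ * (ee ⟪ζ, y⟫ * (starRingEnd ℂ) (g y))) x]
  refine integral_congr_ae (Filter.Eventually.of_forall fun y => ?_)
  simp only
  rw [← mul_assoc, ← ee_add, ← inner_add_right, add_sub_cancel]

theorem temperate_ee : Function.HasTemperateGrowth ee :=
  ⟨contDiff_ee, fun n => ⟨0, (2 * Real.pi) ^ n, fun x => by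
    rw [norm_iteratedFDeriv_ee]; simp⟩⟩

/-- The modulated and translated conjugate window. -/
def phiW (x ξ : EuclideanSpace ℝ (Fin d)) : SchwartzMap (EuclideanSpace ℝ (Fin d)) ℂ :=
  SchwartzMap.smulLeftCLM ℂ (fun y => ee (-⟪ξ, y⟫)) (SchwartzMap.compSubConstCLM ℝ x
    (SchwartzMap.postcompCLM (𝕜 := ℝ) (Complex.conjCLE : ℂ →L[ℝ] ℂ) g))

theorem phiW_apply (x ξ y : EuclideanSpace ℝ (Fin d)) :
    phiW g x ξ y = ee (-⟪ξ, y⟫) * (starRingEnd ℂ) (g (y - x)) := by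
  unfold phiW
  rw [SchwartzMap.smulLeftCLM_apply_apply]
  · rfl
  · have h : Function.HasTemperateGrowth (fun y => -⟪ξ, y⟫) := by
      have : (fun y => -⟪ξ, y⟫) = (-(innerSL ℝ ξ) : EuclideanSpace ℝ (Fin d) →L[ℝ] ℝ) := by
        ext y; simp
      rw [this]
      exact ContinuousLinearMap.hasTemperateGrowth _
    exact temperate_ee.comp h

/-- Gabor transform of the kernel. -/
theorem gaborT_kernel (μ : EuclideanSpace ℝ (Fin d) → ℝ) (Et : EuclideanSpace ℝ (Fin d) → ℂ)
    (t : ℝ) (hE : ∀ φ : SchwartzMap (EuclideanSpace ℝ (Fin d)) ℂ,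
        ∫ x, Et x * φ x =
          ∫ (ξ : EuclideanSpace ℝ (Fin d)),
            Complex.exp (((2 * Real.pi * (t * μ ξ) : ℝ) : ℂ) * Complex.I) *
              ∫ x, Complex.exp (((2 * Real.pi * ⟪ξ, x⟫ : ℝ) : ℂ) * Complex.I) * φ x)
    (x ξ : EuclideanSpace ℝ (Fin d)) :
    gaborT d g Et x ξ = ee (-⟪ξ, x⟫) * oscI μ (gamW g) t x ξ := by
  have h1 := hE (phiW g x ξ)
  have e1 : gaborT d g Et x ξ = ∫ y, Et y * phiW g x ξ y := by
    rw [gaborT_eq]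
    refine integral_congr_ae (Filter.Eventually.of_forall fun y => ?_)
    simp only
    rw [phiW_apply]; ring
  rw [e1, h1]
  unfold oscI
  rw [← integral_const_mul]
  refine integral_congr_ae (Filter.Eventually.of_forall fun η => ?_)
  simp only
  have e2 : ∫ y, Complex.exp (((2 * Real.pi * ⟪η, y⟫ : ℝ) : ℂ) * Complex.I) * phiW g x ξ y =
      ee ⟪η - ξ, x⟫ * gamW g (η - ξ) := by
    rw [← gamW_shift]
    refine integral_congr_ae (Filter.Eventually.of_forall fun y => ?_)
    simp only
    rw [phiW_apply, ← mul_assoc]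
    congr 1
    change ee _ * ee _ = _
    rw [← ee_add, inner_sub_left]; rfl
  rw [e2]
  change ee _ * _ = _
  rw [← mul_assoc, ← mul_assoc, ← ee_add, ← ee_add, inner_sub_left, real_inner_comm x η]
  congr 2
  ring

theorem integrable_conj_window (x : EuclideanSpace ℝ (Fin d)) :
    Integrable fun y => (starRingEnd ℂ) (g (y - x)) := by
  have h : Integrable fun y => g (y - x) := (g.integrable (μ := volume)).comp_sub_right x
  exact (Complex.conjCLE : ℂ →L[ℝ] ℂ).integrable_comp h

theorem continuous_conj_window (x : EuclideanSpace ℝ (Fin d)) :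
    Continuous fun y => (starRingEnd ℂ) (g (y - x)) :=
  Complex.continuous_conj.comp (g.continuous.comp (continuous_id.sub continuous_const))

theorem integrable_gabor {v : EuclideanSpace ℝ (Fin d) → ℂ} (hv : AEStronglyMeasurable v volume)
    {M : ℝ} (hM : ∀ x, ‖v x‖ ≤ M) (x ξ : EuclideanSpace ℝ (Fin d)) :
    Integrable fun y => ee (-⟪ξ, y⟫) * v y * (starRingEnd ℂ) (g (y - x)) := by
  refine (integrable_conj_window g x).bdd_mul (c := M) ?_ ?_
  · refine AEStronglyMeasurable.mul ?_ hv
    exact (continuous_ee.comp (by fun_prop)).aestronglyMeasurable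
  · refine Filter.Eventually.of_forall fun y => ?_
    rw [norm_mul, norm_ee, one_mul]; exact hM y

open scoped FourierTransform in
/-- Inversion. -/
theorem gabor_inversion {v : EuclideanSpace ℝ (Fin d) → ℂ} (hv : Continuous v)
    {M : ℝ} (hM : ∀ x, ‖v x‖ ≤ M) (x : EuclideanSpace ℝ (Fin d))
    (hfin : ∫⁻ ξ, ‖gaborT d g v x ξ‖ₑ < ⊤) :
    v x * (starRingEnd ℂ) (g 0) = ∫ ξ, ee ⟪ξ, x⟫ * gaborT d g v x ξ := by
  set f : EuclideanSpace ℝ (Fin d) → ℂ := fun y => v y * (starRingEnd ℂ) (g (y - x)) with hf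
  have hfc : Continuous f := hv.mul (continuous_conj_window g x)
  have hfi : Integrable f := (integrable_conj_window g x).bdd_mul hv.aestronglyMeasurable
    (Filter.Eventually.of_forall hM)
  have hF : 𝓕 f = fun ξ => gaborT d g v x ξ := by
    ext ξ
    rw [Real.fourier_eq', gaborT_eq]
    refine integral_congr_ae (Filter.Eventually.of_forall fun y => ?_)
    simp only [hf, smul_eq_mul, ee]
    rw [real_inner_comm, mul_assoc (Complex.exp _)]
    congr 2
    push_cast; ring
  have hFi : Integrable (𝓕 f) := by
    refine ⟨?_, ?_⟩
    · exact (VectorFourier.fourierIntegral_continuous Real.continuous_fourierChar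
        (by exact continuous_inner) hfi).aestronglyMeasurable
    · rw [hF]; exact hfin
  have h1 := hfc.fourierInv_fourier_eq hfi hFi
  have h2 := congrFun h1 x
  rw [Real.fourierInv_eq'] at h2
  have h3 : f x = v x * (starRingEnd ℂ) (g 0) := by simp [hf]
  rw [← h3, ← h2, hF]
  refine integral_congr_ae (Filter.Eventually.of_forall fun y => ?_)
  simp only [smul_eq_mul, ee]

theorem sup_le_gabor {v : EuclideanSpace ℝ (Fin d) → ℂ} (hv : Continuous v)
    {M : ℝ} (hM : ∀ x, ‖v x‖ ≤ M) (x : EuclideanSpace ℝ (Fin d)) :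
    ‖v x‖ₑ * ‖g 0‖ₑ ≤ wOneInfNorm d g v := by
  have hle : ∫⁻ ξ, ‖gaborT d g v x ξ‖ₑ ≤ wOneInfNorm d g v :=
    le_iSup (fun x => ∫⁻ ξ, ‖gaborT d g v x ξ‖ₑ) x
  refine le_trans ?_ hle
  by_cases hfin : ∫⁻ ξ, ‖gaborT d g v x ξ‖ₑ < ⊤
  · have h1 := gabor_inversion g hv hM x hfin
    have h2 : ‖v x‖ₑ * ‖g 0‖ₑ = ‖v x * (starRingEnd ℂ) (g 0)‖ₑ := by
      rw [enorm_mul, RCLike.enorm_conj]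
    rw [h2, h1]
    refine (enorm_integral_le_lintegral_enorm _).trans (le_of_eq ?_)
    refine lintegral_congr fun ξ => ?_
    rw [enorm_mul, ← ofReal_norm, norm_ee]; simp
  · rw [not_lt_top_iff] at hfin
    rw [hfin]; exact le_top

end gabor

end PartSec5

section PartSec6

set_option linter.unusedSectionVars false
/-! ## Part 6: norm algebra, free evolution and the Duhamel operator -/

section duhamel
variable {d : ℕ} (g : SchwartzMap (EuclideanSpace ℝ (Fin d)) ℂ)

theorem measurable_gaborT_family {X : Type} [MeasurableSpace X]
    {f : X → EuclideanSpace ℝ (Fin d) → ℂ} (hf : Measurable (Function.uncurry f))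
    {a b : X → EuclideanSpace ℝ (Fin d)} (ha : Measurable a) (hb : Measurable b) :
    Measurable fun p => gaborT d g (f p) (a p) (b p) := by
  simp_rw [gaborT_eq]
  refine (StronglyMeasurable.integral_prod_right
    (f := fun p y => ee (-⟪b p, y⟫) * f p y * (starRingEnd ℂ) (g (y - a p))) ?_).measurable
  refine Measurable.stronglyMeasurable ?_
  refine Measurable.mul (Measurable.mul ?_ hf) ?_
  · exact continuous_ee.measurable.comp
      ((Measurable.inner (hb.comp measurable_fst) measurable_snd).neg)
  · exact Complex.continuous_conj.measurable.comp
      (g.continuous.measurable.comp (measurable_snd.sub (ha.comp measurable_fst)))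

theorem measurable_gaborT {v : EuclideanSpace ℝ (Fin d) → ℂ} (hv : Measurable v)
    (x : EuclideanSpace ℝ (Fin d)) : Measurable fun ξ => gaborT d g v x ξ :=
  measurable_gaborT_family g (f := fun _ => v) (hv.comp measurable_snd) measurable_const
    measurable_id

theorem wNorm_add_le {v v' : EuclideanSpace ℝ (Fin d) → ℂ} (hv : Continuous v)
    {M : ℝ} (hM : ∀ x, ‖v x‖ ≤ M) (hv' : Continuous v') {M' : ℝ} (hM' : ∀ x, ‖v' x‖ ≤ M') :
    wOneInfNorm d g (fun x => v x + v' x) ≤ wOneInfNorm d g v + wOneInfNorm d g v' := by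
  refine iSup_le fun x => ?_
  calc ∫⁻ ξ, ‖gaborT d g (fun x => v x + v' x) x ξ‖ₑ
      ≤ ∫⁻ ξ, (‖gaborT d g v x ξ‖ₑ + ‖gaborT d g v' x ξ‖ₑ) := by
        refine lintegral_mono fun ξ => ?_
        have : gaborT d g (fun x => v x + v' x) x ξ = gaborT d g v x ξ + gaborT d g v' x ξ := by
          simp_rw [gaborT_eq]
          rw [← integral_add (integrable_gabor g hv.aestronglyMeasurable hM x ξ)
            (integrable_gabor g hv'.aestronglyMeasurable hM' x ξ)]
          refine integral_congr_ae (Filter.Eventually.of_forall fun y => ?_)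
          simp only; ring
        rw [this]
        exact enorm_add_le _ _
    _ = (∫⁻ ξ, ‖gaborT d g v x ξ‖ₑ) + ∫⁻ ξ, ‖gaborT d g v' x ξ‖ₑ :=
        lintegral_add_left (measurable_gaborT g hv.measurable x).enorm _
    _ ≤ _ := add_le_add (le_iSup (fun x => ∫⁻ ξ, ‖gaborT d g v x ξ‖ₑ) x)
        (le_iSup (fun x => ∫⁻ ξ, ‖gaborT d g v' x ξ‖ₑ) x)

theorem wNorm_const_mul_le (v : EuclideanSpace ℝ (Fin d) → ℂ) (a : ℂ) :
    wOneInfNorm d g (fun x => a * v x) ≤ ‖a‖ₑ * wOneInfNorm d g v := by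
  refine iSup_le fun x => ?_
  have : ∀ ξ, gaborT d g (fun x => a * v x) x ξ = a * gaborT d g v x ξ := by
    intro ξ
    simp_rw [gaborT_eq]
    rw [← integral_const_mul]
    refine integral_congr_ae (Filter.Eventually.of_forall fun y => ?_)
    simp only; ring
  simp_rw [this]
  calc ∫⁻ ξ, ‖a * gaborT d g v x ξ‖ₑ = ‖a‖ₑ * ∫⁻ ξ, ‖gaborT d g v x ξ‖ₑ := by
        simp_rw [enorm_mul]
        exact lintegral_const_mul' _ _ enorm_ne_top
    _ ≤ _ := by
        gcongr
        exact le_iSup (fun x => ∫⁻ ξ, ‖gaborT d g v x ξ‖ₑ) x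

/-- The inverse Fourier transform of an integrable function. -/
def invF (h : EuclideanSpace ℝ (Fin d) → ℂ) (x : EuclideanSpace ℝ (Fin d)) : ℂ :=
  ∫ ξ, ee ⟪x, ξ⟫ * h ξ

theorem integrable_invF {h : EuclideanSpace ℝ (Fin d) → ℂ} (hh : Integrable h)
    (x : EuclideanSpace ℝ (Fin d)) : Integrable fun ξ => ee ⟪x, ξ⟫ * h ξ := by
  refine hh.bdd_mul (c := 1) ?_ ?_
  · exact (continuous_ee.comp (by fun_prop)).aestronglyMeasurable
  · exact Filter.Eventually.of_forall fun y => (norm_ee _).le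

theorem continuous_invF {h : EuclideanSpace ℝ (Fin d) → ℂ} (hh : Integrable h) :
    Continuous (invF h) := by
  refine continuous_of_dominated (bound := fun ξ => ‖h ξ‖)
    (fun x => (integrable_invF hh x).aestronglyMeasurable) (fun x => ?_) hh.norm ?_
  · exact Filter.Eventually.of_forall fun y => by rw [norm_mul, norm_ee, one_mul]
  · refine Filter.Eventually.of_forall fun y => ?_
    exact (continuous_ee.comp (by fun_prop)).mul continuous_const

theorem norm_invF_le (h : EuclideanSpace ℝ (Fin d) → ℂ) (x : EuclideanSpace ℝ (Fin d)) :
    ‖invF h x‖ ≤ ∫ ξ, ‖h ξ‖ := by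
  refine (norm_integral_le_integral_norm _).trans (le_of_eq ?_)
  simp_rw [norm_mul, norm_ee, one_mul]

theorem gaborT_invF {h : EuclideanSpace ℝ (Fin d) → ℂ} (hh : Integrable h)
    (x ξ : EuclideanSpace ℝ (Fin d)) :
    gaborT d g (invF h) x ξ = ∫ η, h η * (ee ⟪η - ξ, x⟫ * gamW g (η - ξ)) := by
  rw [gaborT_eq]
  have e1 : ∀ y, ee (-⟪ξ, y⟫) * invF h y * (starRingEnd ℂ) (g (y - x)) =
      ∫ η, ee (-⟪ξ, y⟫) * ee ⟪y, η⟫ * ((starRingEnd ℂ) (g (y - x)) * h η) := by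
    intro y
    unfold invF
    rw [← integral_const_mul, ← integral_mul_const]
    refine integral_congr_ae (Filter.Eventually.of_forall fun η => ?_)
    simp only; ring
  simp_rw [e1]
  rw [integral_integral_swap]
  · refine integral_congr_ae (Filter.Eventually.of_forall fun η => ?_)
    simp only
    rw [← gamW_shift, ← integral_const_mul]
    refine integral_congr_ae (Filter.Eventually.of_forall fun y => ?_)
    simp only
    rw [inner_sub_left, sub_eq_add_neg ⟪η, y⟫, ee_add, real_inner_comm y η]
    ring
  · have h1 : Integrable (fun p : EuclideanSpace ℝ (Fin d) × EuclideanSpace ℝ (Fin d) =>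
        (starRingEnd ℂ) (g (p.1 - x)) * h p.2) (volume.prod volume) :=
      (integrable_conj_window g x).mul_prod hh
    refine h1.bdd_mul (c := 1) ?_ ?_
    · refine Continuous.aestronglyMeasurable ?_
      exact (continuous_ee.comp (by fun_prop)).mul (continuous_ee.comp (by fun_prop))
    · exact Filter.Eventually.of_forall fun y => by simp [norm_ee]

theorem wNorm_invF_le {h : EuclideanSpace ℝ (Fin d) → ℂ} (hh : Integrable h) :
    wOneInfNorm d g (invF h) ≤ (∫⁻ ζ, ‖gamW g ζ‖ₑ) * ∫⁻ η, ‖h η‖ₑ := by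
  refine iSup_le fun x => ?_
  calc ∫⁻ ξ, ‖gaborT d g (invF h) x ξ‖ₑ ≤ ∫⁻ ξ, ∫⁻ η, ‖h η‖ₑ * ‖gamW g (η - ξ)‖ₑ := by
        refine lintegral_mono fun ξ => ?_
        simp only
        rw [gaborT_invF g hh]
        refine (enorm_integral_le_lintegral_enorm _).trans (le_of_eq ?_)
        refine lintegral_congr fun η => ?_
        rw [enorm_mul, enorm_mul, ← ofReal_norm (ee _), norm_ee]; simp
    _ = ∫⁻ η, ∫⁻ ξ, ‖h η‖ₑ * ‖gamW g (η - ξ)‖ₑ := by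
        refine lintegral_lintegral_swap ?_
        have m1 : AEMeasurable (fun q : EuclideanSpace ℝ (Fin d) × EuclideanSpace ℝ (Fin d) =>
            ‖h q.2‖ₑ) (volume.prod volume) := (hh.aestronglyMeasurable.comp_snd).enorm
        have m2 : Measurable (fun q : EuclideanSpace ℝ (Fin d) × EuclideanSpace ℝ (Fin d) =>
            ‖gamW g (q.2 - q.1)‖ₑ) :=
          ((gamW g).continuous.comp (continuous_snd.sub continuous_fst)).enorm.measurable
        exact m1.mul m2.aemeasurable
    _ = ∫⁻ η, (∫⁻ ζ, ‖gamW g ζ‖ₑ) * ‖h η‖ₑ := by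
        refine lintegral_congr fun η => ?_
        rw [lintegral_const_mul' _ _ enorm_ne_top,
          lintegral_sub_left_eq_self (fun ζ => ‖gamW g ζ‖ₑ) η, mul_comm]
    _ = _ := lintegral_const_mul'' _ hh.aestronglyMeasurable.enorm

variable {K : ℝ → EuclideanSpace ℝ (Fin d) → ℂ} {k : ℝ → ℝ}
  {ρ : Measure (EuclideanSpace ℝ (Fin d))} [IsFiniteMeasure ρ]

/-- The Duhamel operator, as an integral over space-time. -/
def duh (K : ℝ → EuclideanSpace ℝ (Fin d) → ℂ) (ρ : Measure (EuclideanSpace ℝ (Fin d)))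
    (Φ : ℝ × EuclideanSpace ℝ (Fin d) → ℂ) (x : EuclideanSpace ℝ (Fin d)) : ℂ :=
  ∫ p, K p.1 (x - p.2) * Φ p ∂((volume : Measure ℝ).prod ρ)

/-- The weighted norm controlling the Duhamel operator. -/
def wt (k : ℝ → ℝ) (ρ : Measure (EuclideanSpace ℝ (Fin d)))
    (Φ : ℝ × EuclideanSpace ℝ (Fin d) → ℂ) : ℝ≥0∞ :=
  ∫⁻ p, ENNReal.ofReal (k p.1) * ‖Φ p‖ₑ ∂((volume : Measure ℝ).prod ρ)

/-- The kernel hypotheses. -/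
structure KerHyp (K : ℝ → EuclideanSpace ℝ (Fin d) → ℂ) (k : ℝ → ℝ) : Prop where
  meas : Measurable (Function.uncurry K)
  cont : ∀ s, Continuous (K s)
  kmeas : Measurable k
  le : ∀ s x, ‖K s x‖ ≤ k s
  wle : ∀ s, wOneInfNorm d g (K s) ≤ ENNReal.ofReal (k s)

variable {g}
variable {Φ : ℝ × EuclideanSpace ℝ (Fin d) → ℂ}

theorem KerHyp.nonneg (H : KerHyp g K k) (s : ℝ) : 0 ≤ k s := (norm_nonneg _).trans (H.le s 0)

theorem wt_integrable (H : KerHyp g K k) (hΦ : Measurable Φ) (hfin : wt k ρ Φ < ⊤) :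
    Integrable (fun p => (k p.1 : ℂ) * Φ p) ((volume : Measure ℝ).prod ρ) := by
  refine ⟨?_, ?_⟩
  · exact ((Complex.continuous_ofReal.measurable.comp (H.kmeas.comp measurable_fst)).mul
      hΦ).aestronglyMeasurable
  · refine lt_of_le_of_lt (le_of_eq ?_) hfin
    refine lintegral_congr fun p => ?_
    rw [enorm_mul]
    congr 1
    rw [← ofReal_norm, Complex.norm_real, Real.norm_of_nonneg (H.nonneg _)]

theorem duh_meas (H : KerHyp g K k) (hΦ : Measurable Φ) :
    Measurable fun q : EuclideanSpace ℝ (Fin d) × (ℝ × EuclideanSpace ℝ (Fin d)) =>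
      K q.2.1 (q.1 - q.2.2) * Φ q.2 := by
  refine Measurable.mul ?_ (hΦ.comp measurable_snd)
  exact H.meas.comp ((measurable_fst.comp measurable_snd).prodMk
    (measurable_fst.sub (measurable_snd.comp measurable_snd)))

theorem duh_bound (H : KerHyp g K k) (x : EuclideanSpace ℝ (Fin d))
    (p : ℝ × EuclideanSpace ℝ (Fin d)) :
    ‖K p.1 (x - p.2) * Φ p‖ ≤ ‖(k p.1 : ℂ) * Φ p‖ := by
  rw [norm_mul, norm_mul, Complex.norm_real, Real.norm_of_nonneg (H.nonneg _)]
  gcongr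
  exact H.le _ _

theorem duh_integrable (H : KerHyp g K k) (hΦ : Measurable Φ) (hfin : wt k ρ Φ < ⊤)
    (x : EuclideanSpace ℝ (Fin d)) :
    Integrable (fun p => K p.1 (x - p.2) * Φ p) ((volume : Measure ℝ).prod ρ) :=
  (wt_integrable H hΦ hfin).mono ((duh_meas H hΦ).comp measurable_prodMk_left).aestronglyMeasurable
    (Filter.Eventually.of_forall fun p => duh_bound H x p)

theorem duh_continuous (H : KerHyp g K k) (hΦ : Measurable Φ) (hfin : wt k ρ Φ < ⊤) :
    Continuous (duh K ρ Φ) := by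
  refine continuous_of_dominated (bound := fun p => ‖(k p.1 : ℂ) * Φ p‖)
    (fun x => (duh_integrable H hΦ hfin x).aestronglyMeasurable) (fun x => ?_)
    (wt_integrable H hΦ hfin).norm ?_
  · exact Filter.Eventually.of_forall fun p => duh_bound H x p
  · refine Filter.Eventually.of_forall fun p => ?_
    exact ((H.cont p.1).comp (continuous_id.sub continuous_const)).mul continuous_const

theorem duh_norm_le (H : KerHyp g K k) (hΦ : Measurable Φ) (hfin : wt k ρ Φ < ⊤)
    (x : EuclideanSpace ℝ (Fin d)) :
    ‖duh K ρ Φ x‖ ≤ ∫ p, ‖(k p.1 : ℂ) * Φ p‖ ∂((volume : Measure ℝ).prod ρ) :=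
  norm_integral_le_of_norm_le (wt_integrable H hΦ hfin).norm
    (Filter.Eventually.of_forall fun p => duh_bound H x p)

theorem enorm_gaborT_translate (v : EuclideanSpace ℝ (Fin d) → ℂ)
    (x y ξ : EuclideanSpace ℝ (Fin d)) :
    ‖gaborT d g (fun z => v (z - y)) x ξ‖ₑ = ‖gaborT d g v (x - y) ξ‖ₑ := by
  have e : gaborT d g (fun z => v (z - y)) x ξ = ee (-⟪ξ, y⟫) * gaborT d g v (x - y) ξ := by
    rw [gaborT_eq, gaborT_eq, ← integral_const_mul, ← integral_sub_right_eq_self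
      (fun z => ee (-⟪ξ, y⟫) * (ee (-⟪ξ, z⟫) * v z * (starRingEnd ℂ) (g (z - (x - y))))) y]
    refine integral_congr_ae (Filter.Eventually.of_forall fun z => ?_)
    simp only
    rw [show z - y - (x - y) = z - x by abel, ← mul_assoc, ← mul_assoc, ← ee_add,
      inner_sub_right]
    congr 3
    ring
  rw [e, enorm_mul, ← ofReal_norm (ee _), norm_ee]; simp

theorem gaborT_duh (H : KerHyp g K k) (hΦ : Measurable Φ) (hfin : wt k ρ Φ < ⊤)
    (x ξ : EuclideanSpace ℝ (Fin d)) :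
    gaborT d g (duh K ρ Φ) x ξ =
      ∫ p, Φ p * gaborT d g (fun z => K p.1 (z - p.2)) x ξ ∂((volume : Measure ℝ).prod ρ) := by
  rw [gaborT_eq]
  have e1 : ∀ y, ee (-⟪ξ, y⟫) * duh K ρ Φ y * (starRingEnd ℂ) (g (y - x)) =
      ∫ p, ee (-⟪ξ, y⟫) * (K p.1 (y - p.2) * Φ p) * (starRingEnd ℂ) (g (y - x))
        ∂((volume : Measure ℝ).prod ρ) := by
    intro y
    unfold duh
    rw [← integral_const_mul, ← integral_mul_const]
  simp_rw [e1]
  rw [integral_integral_swap]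
  · refine integral_congr_ae (Filter.Eventually.of_forall fun p => ?_)
    simp only
    rw [gaborT_eq, ← integral_const_mul]
    refine integral_congr_ae (Filter.Eventually.of_forall fun y => ?_)
    simp only; ring
  · have h1 := (integrable_conj_window g x).mul_prod (wt_integrable H hΦ hfin)
    refine h1.mono ?_ ?_
    · refine Measurable.aestronglyMeasurable ?_
      refine Measurable.mul (Measurable.mul ?_ (duh_meas H hΦ)) ?_
      · exact (continuous_ee.comp (by fun_prop)).measurable
      · exact (continuous_conj_window g x).measurable.comp measurable_fst
    · refine Filter.Eventually.of_forall fun q => ?_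
      simp only [Function.uncurry]
      rw [norm_mul, norm_mul, norm_ee, one_mul, norm_mul ((starRingEnd ℂ) _), mul_comm]
      gcongr
      exact duh_bound H _ _

theorem wNorm_duh_le (H : KerHyp g K k) (hΦ : Measurable Φ) (hfin : wt k ρ Φ < ⊤) :
    wOneInfNorm d g (duh K ρ Φ) ≤ wt k ρ Φ := by
  refine iSup_le fun x => ?_
  calc ∫⁻ ξ, ‖gaborT d g (duh K ρ Φ) x ξ‖ₑ
      ≤ ∫⁻ ξ, ∫⁻ p, ‖Φ p‖ₑ * ‖gaborT d g (K p.1) (x - p.2) ξ‖ₑ ∂((volume : Measure ℝ).prod ρ) := by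
        refine lintegral_mono fun ξ => ?_
        simp only
        rw [gaborT_duh H hΦ hfin]
        refine (enorm_integral_le_lintegral_enorm _).trans (le_of_eq ?_)
        refine lintegral_congr fun p => ?_
        rw [enorm_mul, enorm_gaborT_translate]
    _ = ∫⁻ p, ∫⁻ ξ, ‖Φ p‖ₑ * ‖gaborT d g (K p.1) (x - p.2) ξ‖ₑ ∂volume ∂((volume : Measure ℝ).prod ρ) := by
        refine lintegral_lintegral_swap ?_
        refine Measurable.aemeasurable (Measurable.mul (hΦ.comp measurable_snd).enorm ?_)
        refine Measurable.enorm ?_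
        refine measurable_gaborT_family g (X := EuclideanSpace ℝ (Fin d) × (ℝ × EuclideanSpace ℝ (Fin d)))
          (f := fun q => K q.2.1) (a := fun q => x - q.2.2) (b := fun q => q.1) ?_ ?_ measurable_fst
        · exact H.meas.comp (((measurable_fst.comp measurable_snd).comp measurable_fst).prodMk
            measurable_snd)
        · exact measurable_const.sub (measurable_snd.comp measurable_snd)
    _ ≤ _ := by
        refine lintegral_mono fun p => ?_
        simp only
        rw [lintegral_const_mul' _ _ enorm_ne_top, mul_comm]
        gcongr
        exact le_trans (le_iSup (fun x => ∫⁻ ξ, ‖gaborT d g (K p.1) x ξ‖ₑ) (x - p.2)) (H.wle p.1)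
end duhamel

end PartSec6

section PartSec7

/-! ## Part 7: the kernel satisfies the hypotheses -/

theorem measurable_oscI_int {d : ℕ} (μ : EuclideanSpace ℝ (Fin d) → ℝ) (hμ : Measurable μ)
    (γ : SchwartzMap (EuclideanSpace ℝ (Fin d)) ℂ) :
    Measurable fun p : ℝ × EuclideanSpace ℝ (Fin d) => ∫ ξ, oscI μ γ p.1 p.2 ξ := by
  refine (StronglyMeasurable.integral_prod_right
    (f := fun (p : ℝ × EuclideanSpace ℝ (Fin d)) ξ => oscI μ γ p.1 p.2 ξ) ?_).measurable
  unfold oscI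
  refine StronglyMeasurable.integral_prod_right
    (f := fun (q : (ℝ × EuclideanSpace ℝ (Fin d)) × EuclideanSpace ℝ (Fin d)) η =>
      ee (q.1.1 * μ η + ⟪q.1.2, η⟫) * γ (η - q.2)) ?_
  refine Measurable.stronglyMeasurable ?_
  have hγ := γ.continuous.measurable
  have he := continuous_ee.measurable
  refine Measurable.mul ?_ ?_
  · refine he.comp (Measurable.add (Measurable.mul ?_ (hμ.comp measurable_snd)) ?_)
    · exact (measurable_fst.comp measurable_fst).comp measurable_fst
    · exact Measurable.inner ((measurable_snd.comp measurable_fst).comp measurable_fst)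
        measurable_snd
  · exact hγ.comp (measurable_snd.sub (measurable_snd.comp measurable_fst))

theorem kernel_exists (d : ℕ) (hd : 1 ≤ d) (m : ℝ)
    (hmd : 2 * (d : ℝ) < m)
    (μ : EuclideanSpace ℝ (Fin d) → ℝ)
    (hsmooth : ContDiffOn ℝ (⊤ : ℕ∞) μ {x | x ≠ 0})
    (hhom : ∀ c : ℝ, 0 < c → ∀ x : EuclideanSpace ℝ (Fin d), x ≠ 0 →
      μ (c • x) = c ^ m * μ x)
    (hhess : ∀ x : EuclideanSpace ℝ (Fin d), ‖x‖ = 1 →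
      Function.Bijective ⇑(fderiv ℝ (fderiv ℝ μ) x))
    (g : SchwartzMap (EuclideanSpace ℝ (Fin d)) ℂ) (hg : g 0 ≠ 0)
    (EE : ℝ → EuclideanSpace ℝ (Fin d) → ℂ)
    (hEE : ∀ t : ℝ, 0 < t → Continuous (EE t) ∧ (∃ M : ℝ, ∀ x, ‖EE t x‖ ≤ M) ∧
      ∀ φ : SchwartzMap (EuclideanSpace ℝ (Fin d)) ℂ,
        ∫ x, EE t x * φ x =
          ∫ (ξ : EuclideanSpace ℝ (Fin d)),
            Complex.exp (((2 * Real.pi * (t * μ ξ) : ℝ) : ℂ) * Complex.I) *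
              ∫ x, Complex.exp (((2 * Real.pi * ⟪ξ, x⟫ : ℝ) : ℂ) * Complex.I) * φ x) :
    ∃ (K : ℝ → EuclideanSpace ℝ (Fin d) → ℂ) (k : ℝ → ℝ), KerHyp g K k ∧ Integrable k ∧
      (∀ s, 0 < s → s ≤ 1 → K s = EE s) ∧ (∀ s, ¬ (0 < s ∧ s ≤ 1) → K s = 0) := by
  have hd' : (1 : ℝ) ≤ d := by exact_mod_cast hd
  have hμm : Measurable μ :=
    measurable_of_continuousOn_compl_singleton 0 (hsmooth.continuousOn)
  obtain ⟨C, hC, hest⟩ := kernel_estimate d hd m hmd μ hsmooth hhom hhess (gamW g)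
  set θ : ℝ := d / (m - 1) with hθ
  have hθ1 : θ < 1 := by rw [hθ, div_lt_one (by linarith)]; linarith
  have hg0 : 0 < ‖g 0‖ := norm_pos_iff.mpr hg
  set S : Set ℝ := Set.Ioc 0 1 with hS
  set C' : ℝ := C * (1 + ‖g 0‖⁻¹) with hC'
  have hCC' : C ≤ C' := by
    rw [hC', mul_add, mul_one]
    have : 0 ≤ C * ‖g 0‖⁻¹ := by positivity
    linarith
  set k : ℝ → ℝ := S.indicator (fun s => C' * s ^ (-θ)) with hk
  set K : ℝ → EuclideanSpace ℝ (Fin d) → ℂ := fun s => S.indicator EE s with hK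
  have hgab : ∀ s, 0 < s → s ≤ 1 → ∀ x ξ, gaborT d g (EE s) x ξ =
      ee (-⟪ξ, x⟫) * oscI μ (gamW g) s x ξ := fun s h0 h1 x ξ =>
    gaborT_kernel g μ (EE s) s (hEE s h0).2.2 x ξ
  have hgabn : ∀ s, 0 < s → s ≤ 1 → ∀ x ξ, ‖gaborT d g (EE s) x ξ‖ₑ =
      ‖oscI μ (gamW g) s x ξ‖ₑ := by
    intro s h0 h1 x ξ
    rw [hgab s h0 h1, enorm_mul, ← ofReal_norm (ee _), norm_ee]; simp
  have hW : ∀ s, 0 < s → s ≤ 1 → wOneInfNorm d g (EE s) ≤ ENNReal.ofReal (C * s ^ (-θ)) := by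
    intro s h0 h1
    refine iSup_le fun x => ?_
    refine le_trans (le_of_eq ?_) (hest s h0 h1 x)
    exact lintegral_congr fun ξ => hgabn s h0 h1 x ξ
  have hsup : ∀ s, 0 < s → s ≤ 1 → ∀ x, ‖EE s x‖ ≤ C' * s ^ (-θ) := by
    intro s h0 h1 x
    obtain ⟨hc, ⟨M, hM⟩, -⟩ := hEE s h0
    have h2 := (sup_le_gabor g hc hM x).trans (hW s h0 h1)
    rw [← enorm_mul, ← ofReal_norm, ENNReal.ofReal_le_ofReal_iff (by positivity), norm_mul] at h2
    rw [← le_div_iff₀ hg0] at h2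
    refine h2.trans ?_
    rw [hC', mul_add, mul_one, add_mul, div_eq_mul_inv]
    have h3 : 0 ≤ C * s ^ (-θ) := by positivity
    nlinarith
  refine ⟨K, k, ?_, ?_, ?_, ?_⟩
  · constructor
    · have e : Function.uncurry K = Set.indicator (Prod.fst ⁻¹' S)
          (fun p : ℝ × EuclideanSpace ℝ (Fin d) =>
            ((starRingEnd ℂ) (g 0))⁻¹ * ∫ ξ, oscI μ (gamW g) p.1 p.2 ξ) := by
        ext ⟨s, x⟩
        simp only [Function.uncurry, hK]
        by_cases hs : s ∈ S
        · rw [Set.indicator_of_mem hs, Set.indicator_of_mem (by simpa using hs)]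
          obtain ⟨hc, ⟨M, hM⟩, -⟩ := hEE s hs.1
          have h1 := gabor_inversion g hc hM x
            (lt_of_le_of_lt (le_iSup (fun x => ∫⁻ ξ, ‖gaborT d g (EE s) x ξ‖ₑ) x)
              (lt_of_le_of_lt (hW s hs.1 hs.2) ENNReal.ofReal_lt_top))
          have h2 : ∀ ξ, ee ⟪ξ, x⟫ * gaborT d g (EE s) x ξ = oscI μ (gamW g) s x ξ := by
            intro ξ
            rw [hgab s hs.1 hs.2, ← mul_assoc, mul_comm (ee _), ee_neg_mul, one_mul]
          simp_rw [h2] at h1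
          rw [← h1, mul_comm (EE s x), ← mul_assoc, inv_mul_cancel₀ (by simpa using hg), one_mul]
        · rw [Set.indicator_of_notMem hs, Set.indicator_of_notMem (by simpa using hs)]
          rfl
      rw [e]
      exact ((measurable_oscI_int μ hμm (gamW g)).const_mul _).indicator
        (measurable_fst measurableSet_Ioc)
    · intro s
      by_cases hs : s ∈ S
      · simp only [hK, Set.indicator_of_mem hs]; exact (hEE s hs.1).1
      · simp only [hK, Set.indicator_of_notMem hs]; exact continuous_const
    · refine Measurable.indicator ?_ measurableSet_Ioc
      fun_prop
    · intro s x
      by_cases hs : s ∈ S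
      · simp only [hK, hk, Set.indicator_of_mem hs]; exact hsup s hs.1 hs.2 x
      · simp [hK, hk, Set.indicator_of_notMem hs]
    · intro s
      by_cases hs : s ∈ S
      · simp only [hK, hk, Set.indicator_of_mem hs]
        refine (hW s hs.1 hs.2).trans (ENNReal.ofReal_le_ofReal ?_)
        have := Real.rpow_nonneg hs.1.le (-θ)
        gcongr
      · simp only [hK, hk, Set.indicator_of_notMem hs, ENNReal.ofReal_zero]
        refine iSup_le fun x => ?_
        simp [gaborT]
  · rw [hk, integrable_indicator_iff measurableSet_Ioc]
    have := (intervalIntegral.intervalIntegrable_rpow' (a := 0) (b := 1) (r := -θ)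
      (by linarith)).1
    exact this.const_mul C'
  · intro s h0 h1
    simp only [hK]
    exact Set.indicator_of_mem (show s ∈ S from ⟨h0, h1⟩) EE
  · intro s h
    simp only [hK]
    exact Set.indicator_of_notMem (show s ∉ S from fun hs => h ⟨hs.1, hs.2⟩) EE

end PartSec7

section PartSec8

/-! ## Part 8: the nonlinearity -/
open scoped BoundedContinuousFunction

/-- Locally Lipschitz nonlinearity vanishing at zero. -/
structure NL (G : ℂ → ℂ) : Prop where
  lip : ∀ M : ℝ, ∃ Λ : ℝ, 0 ≤ Λ ∧ ∀ z w : ℂ, ‖z‖ ≤ M → ‖w‖ ≤ M → ‖G z - G w‖ ≤ Λ * ‖z - w‖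
  zero : G 0 = 0

theorem pow_sub_pow_le {M : ℝ} (hM : 1 ≤ M) {z w : ℂ} (hz : ‖z‖ ≤ M) (hw : ‖w‖ ≤ M) (j : ℕ) :
    ‖z ^ j - w ^ j‖ ≤ j * M ^ j * ‖z - w‖ := by
  induction j with
  | zero => simp
  | succ j ih =>
    have e : z ^ (j + 1) - w ^ (j + 1) = z ^ j * (z - w) + (z ^ j - w ^ j) * w := by ring
    have hMj : 0 ≤ M ^ j := by positivity
    rw [e]
    refine (norm_add_le _ _).trans ?_
    rw [norm_mul, norm_mul, norm_pow]
    have h1 : ‖z‖ ^ j * ‖z - w‖ ≤ M ^ (j + 1) * ‖z - w‖ := by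
      gcongr ?_ * _
      calc ‖z‖ ^ j ≤ M ^ j := by gcongr
        _ ≤ M ^ (j + 1) := by gcongr; omega
    have h2 : ‖z ^ j - w ^ j‖ * ‖w‖ ≤ j * M ^ j * ‖z - w‖ * M := by gcongr
    push_cast
    calc _ ≤ M ^ (j + 1) * ‖z - w‖ + j * M ^ j * ‖z - w‖ * M := add_le_add h1 h2
      _ = _ := by ring

theorem NL_of_series (G : ℂ → ℂ) (c : ℕ → ℕ → ℂ)
    (hc : ∀ r : ℝ, 0 < r →
      Summable (fun jk : ℕ × ℕ => ‖c jk.1 jk.2‖ * r ^ (jk.1 + jk.2)))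
    (hG : ∀ z : ℂ,
      HasSum (fun jk : ℕ × ℕ => c jk.1 jk.2 * z ^ jk.1 * ((starRingEnd ℂ) z) ^ jk.2) (G z))
    (hG0 : G 0 = 0) : NL G := by
  refine ⟨fun M' => ?_, hG0⟩
  set M := max M' 1 with hM
  have hM1 : 1 ≤ M := le_max_right _ _
  have hs := hc (2 * M) (by linarith)
  refine ⟨∑' jk : ℕ × ℕ, ‖c jk.1 jk.2‖ * (2 * M) ^ (jk.1 + jk.2),
    tsum_nonneg fun jk => by positivity, fun z w hz hw => ?_⟩
  replace hz : ‖z‖ ≤ M := hz.trans (le_max_left _ _)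
  replace hw : ‖w‖ ≤ M := hw.trans (le_max_left _ _)
  have h1 := (hG z).sub (hG w)
  rw [← h1.tsum_eq, ← tsum_mul_right]
  refine tsum_of_norm_bounded ((hs.mul_right _).hasSum) fun ⟨j, k⟩ => ?_
  simp only
  have e : c j k * z ^ j * (starRingEnd ℂ) z ^ k - c j k * w ^ j * (starRingEnd ℂ) w ^ k =
      c j k * (z ^ j * ((starRingEnd ℂ) z ^ k - (starRingEnd ℂ) w ^ k) +
        (z ^ j - w ^ j) * (starRingEnd ℂ) w ^ k) := by ring
  rw [e, norm_mul, mul_assoc]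
  gcongr
  refine (norm_add_le _ _).trans ?_
  have hcz : ‖(starRingEnd ℂ) z‖ ≤ M := by rwa [RCLike.norm_conj]
  have hcw : ‖(starRingEnd ℂ) w‖ ≤ M := by rwa [RCLike.norm_conj]
  have h2 := pow_sub_pow_le hM1 hcz hcw k
  have h3 := pow_sub_pow_le hM1 hz hw j
  rw [← map_sub, RCLike.norm_conj] at h2
  have hjk : ((j + k : ℕ) : ℝ) ≤ 2 ^ (j + k) := by exact_mod_cast (Nat.lt_two_pow_self).le
  rw [norm_mul, norm_mul, norm_pow, norm_pow]
  calc ‖z‖ ^ j * ‖(starRingEnd ℂ) z ^ k - (starRingEnd ℂ) w ^ k‖ +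
        ‖z ^ j - w ^ j‖ * ‖(starRingEnd ℂ) w‖ ^ k
      ≤ M ^ j * (k * M ^ k * ‖z - w‖) + j * M ^ j * ‖z - w‖ * M ^ k := by gcongr
    _ = ((j + k : ℕ) : ℝ) * M ^ (j + k) * ‖z - w‖ := by push_cast; ring
    _ ≤ 2 ^ (j + k) * M ^ (j + k) * ‖z - w‖ := by gcongr
    _ = (2 * M) ^ (j + k) * ‖z - w‖ := by rw [mul_pow]

theorem NL.continuous {G : ℂ → ℂ} (h : NL G) : Continuous G := by
  rw [continuous_iff_continuousAt]
  intro z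
  obtain ⟨Λ, hΛ, hl⟩ := h.lip (‖z‖ + 1)
  have h1 : Filter.Tendsto (fun w => Λ * ‖w - z‖) (nhds z) (nhds 0) := by
    have : Continuous fun w => Λ * ‖w - z‖ := by fun_prop
    simpa using this.tendsto z
  refine tendsto_iff_norm_sub_tendsto_zero.mpr ?_
  refine squeeze_zero' (Filter.Eventually.of_forall fun _ => norm_nonneg _) ?_ h1
  filter_upwards [Metric.ball_mem_nhds z one_pos] with w hw
  refine hl w z ?_ (by linarith)
  have h2 : ‖w - z‖ < 1 := by simpa [dist_eq_norm] using hw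
  have := norm_sub_norm_le w z
  linarith

/-- The Nemytskii operator. -/
def nem {d : ℕ} {G : ℂ → ℂ} (h : NL G) (f : EuclideanSpace ℝ (Fin d) →ᵇ ℂ) :
    EuclideanSpace ℝ (Fin d) →ᵇ ℂ :=
  BoundedContinuousFunction.ofNormedAddCommGroup (fun x => G (f x))
    (h.continuous.comp f.continuous) ((h.lip ‖f‖).choose * ‖f‖) (by
      intro x
      have h1 := (h.lip ‖f‖).choose_spec.2 (f x) 0 (f.norm_coe_le_norm x) (by simp)
      rw [h.zero, sub_zero, sub_zero] at h1
      refine h1.trans ?_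
      exact mul_le_mul_of_nonneg_left (f.norm_coe_le_norm x) (h.lip ‖f‖).choose_spec.1)

theorem nem_apply {d : ℕ} {G : ℂ → ℂ} (h : NL G) (f : EuclideanSpace ℝ (Fin d) →ᵇ ℂ)
    (x : EuclideanSpace ℝ (Fin d)) : nem h f x = G (f x) := rfl

theorem nem_lip {d : ℕ} {G : ℂ → ℂ} (h : NL G) {M Λ : ℝ} (hΛ : 0 ≤ Λ)
    (hl : ∀ z w : ℂ, ‖z‖ ≤ M → ‖w‖ ≤ M → ‖G z - G w‖ ≤ Λ * ‖z - w‖)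
    (f f' : EuclideanSpace ℝ (Fin d) →ᵇ ℂ) (hf : ‖f‖ ≤ M) (hf' : ‖f'‖ ≤ M) :
    ‖nem h f - nem h f'‖ ≤ Λ * ‖f - f'‖ := by
  refine (BoundedContinuousFunction.norm_le (by positivity)).mpr fun x => ?_
  rw [BoundedContinuousFunction.sub_apply, nem_apply, nem_apply]
  refine (hl _ _ ((f.norm_coe_le_norm x).trans hf) ((f'.norm_coe_le_norm x).trans hf')).trans ?_
  gcongr
  exact (f - f').norm_coe_le_norm x

theorem nem_zero {d : ℕ} {G : ℂ → ℂ} (h : NL G) :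
    nem h (0 : EuclideanSpace ℝ (Fin d) →ᵇ ℂ) = 0 := by
  ext x; simp [nem_apply, h.zero]

theorem nem_continuous {d : ℕ} {G : ℂ → ℂ} (h : NL G) :
    Continuous (nem (d := d) h) := by
  rw [continuous_iff_continuousAt]
  intro z
  obtain ⟨Λ, hΛ, hl⟩ := h.lip (‖z‖ + 1)
  have h1 : Filter.Tendsto (fun w => Λ * ‖w - z‖) (nhds z) (nhds 0) := by
    have : Continuous fun w => Λ * ‖w - z‖ := by fun_prop
    simpa using this.tendsto z
  refine tendsto_iff_norm_sub_tendsto_zero.mpr ?_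
  refine squeeze_zero' (Filter.Eventually.of_forall fun _ => norm_nonneg _) ?_ h1
  filter_upwards [Metric.ball_mem_nhds z one_pos] with w hw
  refine nem_lip h hΛ hl w z ?_ (by linarith)
  have h2 : ‖w - z‖ < 1 := by rw [← dist_eq_norm]; exact hw
  have := norm_sub_norm_le w z
  linarith

end PartSec8

section PartSec9

/-! ## Part 9: the Duhamel map -/
open scoped BoundedContinuousFunction

/-- The source density. -/
def phi {d : ℕ} (w : EuclideanSpace ℝ (Fin d) → ℂ) (F : ℝ → EuclideanSpace ℝ (Fin d) →ᵇ ℂ)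
    (p : ℝ × EuclideanSpace ℝ (Fin d)) : ℂ := F p.1 p.2 * w p.2

/-- Admissible source. -/
structure Adm {d : ℕ} (F : ℝ → EuclideanSpace ℝ (Fin d) →ᵇ ℂ) : Prop where
  sm : StronglyMeasurable F
  bd : ∃ c : ℝ, ∀ s, ‖F s‖ ≤ c

theorem Adm.sub {d : ℕ} {F F' : ℝ → EuclideanSpace ℝ (Fin d) →ᵇ ℂ} (h : Adm F) (h' : Adm F') :
    Adm (fun s => F s - F' s) := by
  obtain ⟨c, hc⟩ := h.bd
  obtain ⟨c', hc'⟩ := h'.bd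
  exact ⟨h.sm.sub h'.sm, c + c', fun s => (norm_sub_le _ _).trans (add_le_add (hc s) (hc' s))⟩

theorem measurable_phi {d : ℕ} {w : EuclideanSpace ℝ (Fin d) → ℂ} (hw : Measurable w)
    {F : ℝ → EuclideanSpace ℝ (Fin d) →ᵇ ℂ} (hF : StronglyMeasurable F) :
    Measurable (phi w F) := by
  refine Measurable.mul ?_ (hw.comp measurable_snd)
  have h1 : StronglyMeasurable fun p : ℝ × EuclideanSpace ℝ (Fin d) => (F p.1, p.2) :=
    (hF.comp_measurable measurable_fst).prodMk measurable_snd.stronglyMeasurable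
  have h2 : Continuous fun q : (EuclideanSpace ℝ (Fin d) →ᵇ ℂ) × EuclideanSpace ℝ (Fin d) =>
      q.1 q.2 := continuous_eval
  exact (h2.comp_stronglyMeasurable h1).measurable

section
variable {d : ℕ} {g : SchwartzMap (EuclideanSpace ℝ (Fin d)) ℂ}
  {K : ℝ → EuclideanSpace ℝ (Fin d) → ℂ} {k : ℝ → ℝ}
  {ρ : Measure (EuclideanSpace ℝ (Fin d))} [IsFiniteMeasure ρ]
  {w : EuclideanSpace ℝ (Fin d) → ℂ} {F : ℝ → EuclideanSpace ℝ (Fin d) →ᵇ ℂ}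

theorem Adm.integrable (_H : KerHyp g K k) (hki : Integrable k) (hF : Adm F) :
    Integrable fun s => k s * ‖F s‖ := by
  obtain ⟨c, hc⟩ := hF.bd
  exact hki.mul_bdd (c := c) hF.sm.norm.aestronglyMeasurable
    (Filter.Eventually.of_forall fun s => by simpa using hc s)

theorem wt_phi_le (H : KerHyp g K k) (hki : Integrable k) (hw : Measurable w)
    (hw1 : ∀ x, ‖w x‖ ≤ 1) (hF : Adm F) :
    wt k ρ (phi w F) ≤ ENNReal.ofReal (ρ.real Set.univ * ∫ s, k s * ‖F s‖) := by
  unfold wt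
  have hm : Measurable fun s => ENNReal.ofReal (k s) * ‖F s‖ₑ :=
    H.kmeas.ennreal_ofReal.mul hF.sm.enorm
  calc ∫⁻ p, ENNReal.ofReal (k p.1) * ‖phi w F p‖ₑ ∂((volume : Measure ℝ).prod ρ)
      ≤ ∫⁻ p, (ENNReal.ofReal (k p.1) * ‖F p.1‖ₑ) * 1 ∂((volume : Measure ℝ).prod ρ) := by
        refine lintegral_mono fun p => ?_
        simp only [mul_one]
        gcongr
        rw [← ofReal_norm, ← ofReal_norm]
        refine ENNReal.ofReal_le_ofReal ?_
        unfold phi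
        rw [norm_mul]
        calc ‖F p.1 p.2‖ * ‖w p.2‖ ≤ ‖F p.1‖ * 1 := by
              gcongr
              · exact (F p.1).norm_coe_le_norm _
              · exact hw1 _
          _ = _ := mul_one _
    _ = (∫⁻ s, ENNReal.ofReal (k s) * ‖F s‖ₑ) * ∫⁻ _, 1 ∂ρ :=
        lintegral_prod_mul hm.aemeasurable aemeasurable_const
    _ = _ := by
        rw [lintegral_one, ENNReal.ofReal_mul measureReal_nonneg, mul_comm, ofReal_measureReal,
          ofReal_integral_eq_lintegral_ofReal (hF.integrable H hki)
          (Filter.Eventually.of_forall fun s => mul_nonneg (H.nonneg s) (norm_nonneg _))]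
        congr 1
        refine lintegral_congr fun s => ?_
        rw [ENNReal.ofReal_mul (H.nonneg s), ofReal_norm]

theorem wt_phi_lt (H : KerHyp g K k) (hki : Integrable k) (hw : Measurable w)
    (hw1 : ∀ x, ‖w x‖ ≤ 1) (hF : Adm F) : wt k ρ (phi w F) < ⊤ :=
  (wt_phi_le H hki hw hw1 hF).trans_lt ENNReal.ofReal_lt_top

/-- The affine Duhamel expression. -/
def QQ (K : ℝ → EuclideanSpace ℝ (Fin d) → ℂ) (ρ : Measure (EuclideanSpace ℝ (Fin d)))
    (w : EuclideanSpace ℝ (Fin d) → ℂ) (h : EuclideanSpace ℝ (Fin d) → ℂ)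
    (F : ℝ → EuclideanSpace ℝ (Fin d) →ᵇ ℂ) (x : EuclideanSpace ℝ (Fin d)) : ℂ :=
  invF h x + (2 * (π : ℂ)) * I * duh K ρ (phi w F) x

/-- Constant in front of the data. -/
def AA (g : SchwartzMap (EuclideanSpace ℝ (Fin d)) ℂ) : ℝ := max 1 (∫⁻ ζ, ‖gamW g ζ‖ₑ).toReal

/-- The bound. -/
def BB (g : SchwartzMap (EuclideanSpace ℝ (Fin d)) ℂ) (k : ℝ → ℝ)
    (ρ : Measure (EuclideanSpace ℝ (Fin d))) (h : EuclideanSpace ℝ (Fin d) → ℂ)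
    (F : ℝ → EuclideanSpace ℝ (Fin d) →ᵇ ℂ) : ℝ :=
  AA g * (∫ ξ, ‖h ξ‖) + 2 * π * ρ.real Set.univ * ∫ s, k s * ‖F s‖

theorem AA_one (g : SchwartzMap (EuclideanSpace ℝ (Fin d)) ℂ) : 1 ≤ AA g := le_max_left _ _

variable {h : EuclideanSpace ℝ (Fin d) → ℂ}

theorem QQ_continuous (H : KerHyp g K k) (hki : Integrable k) (hw : Measurable w)
    (hw1 : ∀ x, ‖w x‖ ≤ 1) (hF : Adm F) (hh : Integrable h) : Continuous (QQ K ρ w h F) :=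
  (continuous_invF hh).add (continuous_const.mul
    (duh_continuous H (measurable_phi hw hF.sm) (wt_phi_lt H hki hw hw1 hF)))

theorem norm_twopiI : ‖(2 * (π : ℂ)) * I‖ = 2 * π := by
  simp [abs_of_pos Real.pi_pos]

theorem duh_phi_norm_le (H : KerHyp g K k) (hki : Integrable k) (hw : Measurable w)
    (hw1 : ∀ x, ‖w x‖ ≤ 1) (hF : Adm F) (x : EuclideanSpace ℝ (Fin d)) :
    ‖duh K ρ (phi w F) x‖ ≤ ρ.real Set.univ * ∫ s, k s * ‖F s‖ := by
  have hm := measurable_phi hw hF.sm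
  have hf := wt_phi_lt (ρ := ρ) H hki hw hw1 hF
  refine (duh_norm_le H hm hf x).trans ?_
  rw [integral_norm_eq_lintegral_enorm (wt_integrable H hm hf).aestronglyMeasurable]
  have h0 : 0 ≤ ρ.real Set.univ * ∫ s, k s * ‖F s‖ := mul_nonneg measureReal_nonneg
    (integral_nonneg fun s => mul_nonneg (H.nonneg s) (norm_nonneg _))
  refine ENNReal.toReal_le_of_le_ofReal h0 ((le_of_eq ?_).trans (wt_phi_le H hki hw hw1 hF))
  refine lintegral_congr fun p => ?_
  rw [enorm_mul, ← ofReal_norm (k p.1 : ℂ), Complex.norm_real, Real.norm_of_nonneg (H.nonneg _)]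

theorem QQ_norm_le (H : KerHyp g K k) (hki : Integrable k) (hw : Measurable w)
    (hw1 : ∀ x, ‖w x‖ ≤ 1) (hF : Adm F) (x : EuclideanSpace ℝ (Fin d)) :
    ‖QQ K ρ w h F x‖ ≤ BB g k ρ h F := by
  unfold QQ BB
  refine (norm_add_le _ _).trans ?_
  rw [norm_mul, norm_twopiI, mul_assoc (2 * π)]
  refine add_le_add ?_ (by gcongr; exact duh_phi_norm_le H hki hw hw1 hF x)
  refine (norm_invF_le h x).trans ?_
  exact le_mul_of_one_le_left (integral_nonneg fun _ => norm_nonneg _) (AA_one g)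

theorem QQ_w_le (H : KerHyp g K k) (hki : Integrable k) (hw : Measurable w)
    (hw1 : ∀ x, ‖w x‖ ≤ 1) (hF : Adm F) (hh : Integrable h) :
    wOneInfNorm d g (QQ K ρ w h F) ≤ ENNReal.ofReal (BB g k ρ h F) := by
  have hm := measurable_phi hw hF.sm
  have hf := wt_phi_lt (ρ := ρ) H hki hw hw1 hF
  have h0 : 0 ≤ ρ.real Set.univ * ∫ s, k s * ‖F s‖ := mul_nonneg measureReal_nonneg
    (integral_nonneg fun s => mul_nonneg (H.nonneg s) (norm_nonneg _))
  have h1 : 0 ≤ ∫ ξ, ‖h ξ‖ := integral_nonneg fun _ => norm_nonneg _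
  have hA : 0 ≤ AA g := zero_le_one.trans (AA_one g)
  have e := wNorm_add_le g (continuous_invF hh) (norm_invF_le h)
    (v' := fun x => (2 * (π : ℂ)) * I * duh K ρ (phi w F) x)
    (continuous_const.mul (duh_continuous H hm hf))
    (M' := 2 * π * (ρ.real Set.univ * ∫ s, k s * ‖F s‖)) (fun x => by
      rw [norm_mul, norm_twopiI]; gcongr; exact duh_phi_norm_le H hki hw hw1 hF x)
  refine e.trans ?_
  unfold BB
  rw [ENNReal.ofReal_add (by positivity) (by rw [mul_assoc]; positivity)]
  refine add_le_add ?_ ?_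
  · refine (wNorm_invF_le g hh).trans ?_
    rw [ENNReal.ofReal_mul hA, ofReal_integral_norm_eq_lintegral_enorm hh]
    gcongr
    have hg : (∫⁻ ζ, ‖gamW g ζ‖ₑ) < ⊤ := (gamW g).integrable.2
    rw [← ENNReal.ofReal_toReal hg.ne]
    exact ENNReal.ofReal_le_ofReal (le_max_right _ _)
  · refine (wNorm_const_mul_le g _ _).trans ?_
    rw [← ofReal_norm, norm_twopiI, mul_assoc (2 * π), ENNReal.ofReal_mul (p := 2 * π) (by positivity)]
    refine mul_le_mul' le_rfl ?_
    exact (wNorm_duh_le H hm hf).trans (wt_phi_le H hki hw hw1 hF)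

theorem QQ_sub (H : KerHyp g K k) (hki : Integrable k) (hw : Measurable w)
    (hw1 : ∀ x, ‖w x‖ ≤ 1) {F' : ℝ → EuclideanSpace ℝ (Fin d) →ᵇ ℂ} (hF : Adm F) (hF' : Adm F')
    {h' : EuclideanSpace ℝ (Fin d) → ℂ}
    (hh : Integrable h) (hh' : Integrable h') (x : EuclideanSpace ℝ (Fin d)) :
    QQ K ρ w h F x - QQ K ρ w h' F' x = QQ K ρ w (fun ξ => h ξ - h' ξ) (fun s => F s - F' s) x := by
  have e1 : invF h x - invF h' x = invF (fun ξ => h ξ - h' ξ) x := by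
    unfold invF
    rw [← integral_sub (integrable_invF hh x) (integrable_invF hh' x)]
    congr 1; ext ξ; ring
  have e2 : duh K ρ (phi w F) x - duh K ρ (phi w F') x
      = duh K ρ (phi w (fun s => F s - F' s)) x := by
    unfold duh
    rw [← integral_sub
      (duh_integrable H (measurable_phi hw hF.sm) (wt_phi_lt H hki hw hw1 hF) x)
      (duh_integrable H (measurable_phi hw hF'.sm) (wt_phi_lt H hki hw hw1 hF') x)]
    congr 1; ext p; simp only [phi, BoundedContinuousFunction.sub_apply]; ring
  unfold QQ
  rw [← e1, ← e2]; ring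
end

end PartSec9

section PartSec10

set_option linter.unusedSectionVars false
/-! ## Part 10: evolution -/
open scoped BoundedContinuousFunction

section
variable {d : ℕ} {g : SchwartzMap (EuclideanSpace ℝ (Fin d)) ℂ}
  {K : ℝ → EuclideanSpace ℝ (Fin d) → ℂ} {k : ℝ → ℝ}
  {ρ : Measure (EuclideanSpace ℝ (Fin d))} [IsFiniteMeasure ρ]
  {w : EuclideanSpace ℝ (Fin d) → ℂ} {μ : EuclideanSpace ℝ (Fin d) → ℝ} {G : ℂ → ℂ}
  {h h' : EuclideanSpace ℝ (Fin d) → ℂ}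
  {U U' : ℝ → EuclideanSpace ℝ (Fin d) →ᵇ ℂ}

/-- Evolved Fourier data. -/
def hv (μ : EuclideanSpace ℝ (Fin d) → ℝ) (h : EuclideanSpace ℝ (Fin d) → ℂ) (t : ℝ)
    (ξ : EuclideanSpace ℝ (Fin d)) : ℂ := ee (t * μ ξ) * h ξ

theorem hv_norm (t : ℝ) (ξ : EuclideanSpace ℝ (Fin d)) : ‖hv μ h t ξ‖ = ‖h ξ‖ := by
  unfold hv; rw [norm_mul, norm_ee, one_mul]

theorem hv_integrable (hμ : Measurable μ) (hh : Integrable h) (t : ℝ) : Integrable (hv μ h t) := by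
  refine hh.mono ?_ (Filter.Eventually.of_forall fun ξ => (hv_norm t ξ).le)
  exact ((continuous_ee.measurable.comp (hμ.const_mul t)).aestronglyMeasurable).mul
    hh.aestronglyMeasurable

theorem hv_sub (t : ℝ) : (fun ξ => hv μ h t ξ - hv μ h' t ξ) = hv μ (fun ξ => h ξ - h' ξ) t := by
  ext ξ; unfold hv; ring

/-- The source in the Duhamel formula at time `t`. -/
def Fop (hN : NL G) (U : ℝ → EuclideanSpace ℝ (Fin d) →ᵇ ℂ) (t : ℝ) :
    ℝ → EuclideanSpace ℝ (Fin d) →ᵇ ℂ :=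
  (Set.Ioo 0 t).indicator fun s => nem hN (U (t - s))

theorem Fop_bdd (hN : NL G) (hU : Continuous U) (T : ℝ) :
    ∃ c : ℝ, 0 ≤ c ∧ ∀ t ≤ T, ∀ s, ‖Fop hN U t s‖ ≤ c := by
  have hc : Continuous fun r => ‖nem hN (U r)‖ := ((nem_continuous hN).comp hU).norm
  obtain ⟨c, hc⟩ := (isCompact_Icc (a := (0 : ℝ)) (b := T)).bddAbove_image hc.continuousOn
  refine ⟨max c 0, le_max_right _ _, fun t ht s => ?_⟩
  unfold Fop
  by_cases hs : s ∈ Set.Ioo 0 t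
  · rw [Set.indicator_of_mem hs]
    refine le_trans (hc ⟨t - s, ⟨by linarith [hs.2], by linarith [hs.1]⟩, rfl⟩) (le_max_left _ _)
  · rw [Set.indicator_of_notMem hs, norm_zero]; exact le_max_right _ _

theorem Fop_adm (hN : NL G) (hU : Continuous U) (t : ℝ) : Adm (Fop hN U t) := by
  obtain ⟨c, -, hc⟩ := Fop_bdd hN hU t
  refine ⟨?_, c, hc t le_rfl⟩
  have : Continuous fun s => nem hN (U (t - s)) := (nem_continuous hN).comp (hU.comp (by fun_prop))
  exact this.stronglyMeasurable.indicator measurableSet_Ioo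

theorem Fop_diff_le (hN : NL G) {M Λ : ℝ} (hΛ : 0 ≤ Λ)
    (hl : ∀ z w : ℂ, ‖z‖ ≤ M → ‖w‖ ≤ M → ‖G z - G w‖ ≤ Λ * ‖z - w‖) {t : ℝ}
    (hM : ∀ r ∈ Set.Icc 0 t, ‖U r‖ ≤ M) (hM' : ∀ r ∈ Set.Icc 0 t, ‖U' r‖ ≤ M)
    {D : ℝ → ℝ} (hD : ∀ r ∈ Set.Icc 0 t, ‖U r - U' r‖ ≤ D r) (s : ℝ) :
    ‖Fop hN U t s - Fop hN U' t s‖ ≤ (Set.Ioo 0 t).indicator (fun s => Λ * D (t - s)) s := by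
  unfold Fop
  by_cases hs : s ∈ Set.Ioo 0 t
  · have hr : t - s ∈ Set.Icc 0 t := ⟨by linarith [hs.2], by linarith [hs.1]⟩
    rw [Set.indicator_of_mem hs, Set.indicator_of_mem hs, Set.indicator_of_mem hs]
    refine (nem_lip hN hΛ hl _ _ (hM _ hr) (hM' _ hr)).trans ?_
    gcongr
    exact hD _ hr
  · rw [Set.indicator_of_notMem hs, Set.indicator_of_notMem hs, Set.indicator_of_notMem hs]
    simp

theorem BB_diff_le (H : KerHyp g K k) (hki : Integrable k) (hN : NL G) {M Λ : ℝ} (hΛ : 0 ≤ Λ)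
    (hl : ∀ z w : ℂ, ‖z‖ ≤ M → ‖w‖ ≤ M → ‖G z - G w‖ ≤ Λ * ‖z - w‖) {t : ℝ}
    (hU : Continuous U) (hU' : Continuous U')
    (hM : ∀ r ∈ Set.Icc 0 t, ‖U r‖ ≤ M) (hM' : ∀ r ∈ Set.Icc 0 t, ‖U' r‖ ≤ M)
    {D : ℝ → ℝ} (hDc : Continuous D) (hD : ∀ r ∈ Set.Icc 0 t, ‖U r - U' r‖ ≤ D r) :
    BB g k ρ (fun ξ => hv μ h t ξ - hv μ h' t ξ) (fun s => Fop hN U t s - Fop hN U' t s) ≤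
      AA g * (∫ ξ, ‖h ξ - h' ξ‖) +
        2 * π * ρ.real Set.univ * Λ * ∫ s in Set.Ioo 0 t, k s * D (t - s) := by
  unfold BB
  rw [hv_sub]
  simp_rw [hv_norm]
  rw [mul_assoc _ Λ, ← integral_const_mul Λ, ← integral_indicator measurableSet_Ioo]
  refine add_le_add le_rfl ?_
  refine mul_le_mul_of_nonneg_left ?_ (by positivity)
  obtain ⟨c, hc⟩ := (isCompact_Icc (a := (0 : ℝ)) (b := t)).bddAbove_image hDc.norm.continuousOn
  have hintg : IntegrableOn (fun s => Λ * (k s * D (t - s))) (Set.Ioo 0 t) := by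
    refine Integrable.const_mul ?_ _
    refine (hki.integrableOn (s := Set.Ioo 0 t)).mul_bdd (c := c) ?_ ?_
    · exact (hDc.comp (by fun_prop : Continuous fun s => t - s)).aestronglyMeasurable
    · refine (ae_restrict_iff' measurableSet_Ioo).mpr (Filter.Eventually.of_forall fun s hs => ?_)
      exact hc ⟨t - s, ⟨by linarith [hs.2], by linarith [hs.1]⟩, rfl⟩
  refine integral_mono (((Fop_adm hN hU t).sub (Fop_adm hN hU' t)).integrable H hki)
    (hintg.integrable_indicator measurableSet_Ioo) fun s => ?_
  have := Fop_diff_le hN hΛ hl hM hM' hD s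
  simp only
  refine (mul_le_mul_of_nonneg_left this (H.nonneg s)).trans (le_of_eq ?_)
  by_cases hs : s ∈ Set.Ioo 0 t
  · rw [Set.indicator_of_mem hs, Set.indicator_of_mem hs]; ring
  · rw [Set.indicator_of_notMem hs, Set.indicator_of_notMem hs]; ring

theorem Fop_tendsto (hN : NL G) (hU : Continuous U) {t s : ℝ} (hst : s ≠ t) :
    Filter.Tendsto (fun t' => Fop hN U t' s) (nhds t) (nhds (Fop hN U t s)) := by
  unfold Fop
  have hc : Continuous fun t' => nem hN (U (t' - s)) := (nem_continuous hN).comp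
    (hU.comp (by fun_prop))
  rcases le_or_gt s 0 with h0 | h0
  · have : ∀ t', (Set.Ioo 0 t').indicator (fun s => nem hN (U (t' - s))) s = 0 := fun t' =>
      Set.indicator_of_notMem (fun hs => absurd hs.1 (not_lt.mpr h0)) _
    simp_rw [this]; exact tendsto_const_nhds
  rcases lt_or_gt_of_ne hst with h1 | h1
  · rw [Set.indicator_of_mem (show s ∈ Set.Ioo 0 t from ⟨h0, h1⟩)]
    refine (hc.tendsto t).congr' ?_
    filter_upwards [lt_mem_nhds h1] with t' ht'
    rw [Set.indicator_of_mem (show s ∈ Set.Ioo 0 t' from ⟨h0, ht'⟩)]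
  · rw [Set.indicator_of_notMem (fun hs => absurd hs.2 (not_lt.mpr h1.le))]
    refine tendsto_const_nhds.congr' ?_
    filter_upwards [gt_mem_nhds h1] with t' ht'
    rw [Set.indicator_of_notMem (fun hs => absurd hs.2 (not_lt.mpr (le_of_lt ht')))]

theorem BB_tendsto (H : KerHyp g K k) (hki : Integrable k) (hN : NL G) (hμ : Measurable μ)
    (hh : Integrable h) (hU : Continuous U) (t : ℝ) :
    Filter.Tendsto (fun t' => BB g k ρ (fun ξ => hv μ h t' ξ - hv μ h t ξ)
      (fun s => Fop hN U t' s - Fop hN U t s)) (nhds t) (nhds 0) := by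
  have h1 : Filter.Tendsto (fun t' => ∫ ξ, ‖hv μ h t' ξ - hv μ h t ξ‖) (nhds t) (nhds 0) := by
    have : Continuous fun t' => ∫ ξ, ‖hv μ h t' ξ - hv μ h t ξ‖ := by
      refine continuous_of_dominated (bound := fun ξ => ‖h ξ‖ + ‖h ξ‖) (fun t' =>
        ((hv_integrable hμ hh t').sub (hv_integrable hμ hh t)).norm.aestronglyMeasurable)
        (fun t' => ?_) (hh.norm.add hh.norm) ?_
      · refine Filter.Eventually.of_forall fun ξ => ?_
        rw [norm_norm]
        refine (norm_sub_le _ _).trans ?_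
        rw [hv_norm, hv_norm]
      · refine Filter.Eventually.of_forall fun ξ => ?_
        unfold hv
        have := continuous_ee
        fun_prop
    simpa using this.tendsto t
  have h2 : Filter.Tendsto (fun t' => ∫ s, k s * ‖Fop hN U t' s - Fop hN U t s‖)
      (nhds t) (nhds 0) := by
    obtain ⟨c, hc0, hc⟩ := Fop_bdd hN hU (t + 1)
    have := tendsto_integral_filter_of_dominated_convergence (μ := volume) (l := nhds t)
      (F := fun t' s => k s * ‖Fop hN U t' s - Fop hN U t s‖) (f := fun _ => 0)
      (fun s => k s * (c + c)) ?_ ?_ (hki.mul_const _) ?_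
    · simpa using this
    · refine Filter.Eventually.of_forall fun t' => ?_
      exact (((Fop_adm hN hU t').sub (Fop_adm hN hU t)).integrable H hki).aestronglyMeasurable
    · filter_upwards [gt_mem_nhds (lt_add_one t)] with t' ht'
      refine Filter.Eventually.of_forall fun s => ?_
      rw [norm_mul, norm_norm, Real.norm_of_nonneg (H.nonneg s)]
      refine mul_le_mul_of_nonneg_left ?_ (H.nonneg s)
      exact (norm_sub_le _ _).trans (add_le_add (hc _ (le_of_lt ht') s) (hc _ (by linarith) s))
    · have : ∀ᵐ s : ℝ, s ≠ t := by simp [ae_iff]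
      filter_upwards [this] with s hs
      have := ((Fop_tendsto hN hU hs).sub_const (Fop hN U t s)).norm.const_mul (k s)
      simpa using this
  have := (h1.const_mul (AA g)).add (h2.const_mul (2 * π * ρ.real Set.univ))
  simpa [BB] using this

theorem exp_weight (H : KerHyp g K k) (hki : Integrable k) {ε : ℝ} (hε : 0 < ε) :
    ∃ l : ℝ, 0 < l ∧ ∫ s in Set.Ioi 0, k s * Real.exp (-(l * s)) < ε := by
  have h1 : Filter.Tendsto (fun n : ℕ => ∫ s in Set.Ioi (0 : ℝ), k s * Real.exp (-(n * s)))
      Filter.atTop (nhds 0) := by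
    have := tendsto_integral_of_dominated_convergence (μ := volume.restrict (Set.Ioi (0:ℝ)))
      (F := fun (n : ℕ) s => k s * Real.exp (-(n * s))) (f := fun _ => 0) k ?_
      hki.integrableOn ?_ ?_
    · simpa using this
    · intro n
      exact (H.kmeas.mul (by fun_prop)).aestronglyMeasurable
    · intro n
      refine (ae_restrict_iff' measurableSet_Ioi).mpr (Filter.Eventually.of_forall fun s hs => ?_)
      rw [norm_mul, Real.norm_of_nonneg (H.nonneg s), Real.norm_of_nonneg (Real.exp_pos _).le]
      refine mul_le_of_le_one_right (H.nonneg s) ?_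
      rw [Real.exp_le_one_iff]
      have : (0:ℝ) < s := hs
      have : 0 ≤ (n : ℝ) * s := by positivity
      linarith
    · refine (ae_restrict_iff' measurableSet_Ioi).mpr (Filter.Eventually.of_forall fun s hs => ?_)
      have : (0:ℝ) < s := hs
      have h2 : Filter.Tendsto (fun n : ℕ => Real.exp (-((n : ℝ) * s))) Filter.atTop (nhds 0) :=
        Real.tendsto_exp_neg_atTop_nhds_zero.comp
          (tendsto_natCast_atTop_atTop.atTop_mul_const this)
      simpa using h2.const_mul (k s)
  obtain ⟨n, hn, hn1⟩ := ((h1.eventually (gt_mem_nhds hε)).and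
    (Filter.eventually_ge_atTop 1)).exists
  exact ⟨n, by exact_mod_cast hn1, hn⟩

/-- The Duhamel map. -/
def QU (K : ℝ → EuclideanSpace ℝ (Fin d) → ℂ) (ρ : Measure (EuclideanSpace ℝ (Fin d)))
    (w : EuclideanSpace ℝ (Fin d) → ℂ) (μ : EuclideanSpace ℝ (Fin d) → ℝ)
    (hN : NL G) (h : EuclideanSpace ℝ (Fin d) → ℂ)
    (U : ℝ → EuclideanSpace ℝ (Fin d) →ᵇ ℂ) (t : ℝ) : EuclideanSpace ℝ (Fin d) → ℂ :=
  QQ K ρ w (hv μ h t) (Fop hN U t)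

theorem QU_diff (H : KerHyp g K k) (hki : Integrable k) (hw : Measurable w)
    (hw1 : ∀ x, ‖w x‖ ≤ 1) (hN : NL G) (hμ : Measurable μ)
    (hh : Integrable h) (hh' : Integrable h') (hU : Continuous U) (hU' : Continuous U')
    {M Λ : ℝ} (hΛ : 0 ≤ Λ)
    (hl : ∀ z w : ℂ, ‖z‖ ≤ M → ‖w‖ ≤ M → ‖G z - G w‖ ≤ Λ * ‖z - w‖) {t : ℝ}
    (hM : ∀ r ∈ Set.Icc 0 t, ‖U r‖ ≤ M) (hM' : ∀ r ∈ Set.Icc 0 t, ‖U' r‖ ≤ M)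
    {D : ℝ → ℝ} (hDc : Continuous D) (hD : ∀ r ∈ Set.Icc 0 t, ‖U r - U' r‖ ≤ D r) :
    (∀ x, ‖QU K ρ w μ hN h U t x - QU K ρ w μ hN h' U' t x‖ ≤ AA g * (∫ ξ, ‖h ξ - h' ξ‖) +
        2 * π * ρ.real Set.univ * Λ * ∫ s in Set.Ioo 0 t, k s * D (t - s)) ∧
    wOneInfNorm d g (fun x => QU K ρ w μ hN h U t x - QU K ρ w μ hN h' U' t x) ≤
      ENNReal.ofReal (AA g * (∫ ξ, ‖h ξ - h' ξ‖) +
        2 * π * ρ.real Set.univ * Λ * ∫ s in Set.Ioo 0 t, k s * D (t - s)) := by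
  have hB := BB_diff_le (g := g) (ρ := ρ) (μ := μ) (h := h) (h' := h') H hki hN hΛ hl hU hU' hM hM'
    hDc hD
  have hA := (Fop_adm hN hU t).sub (Fop_adm hN hU' t)
  have hi := (hv_integrable hμ hh t).sub (hv_integrable hμ hh' t)
  have e : ∀ x, QU K ρ w μ hN h U t x - QU K ρ w μ hN h' U' t x = _ := fun x =>
    QQ_sub H hki hw hw1 (Fop_adm hN hU t) (Fop_adm hN hU' t) (hv_integrable hμ hh t)
      (hv_integrable hμ hh' t) x
  simp_rw [e]
  exact ⟨fun x => (QQ_norm_le H hki hw hw1 hA x).trans hB,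
    (QQ_w_le H hki hw hw1 hA hi).trans (ENNReal.ofReal_le_ofReal hB)⟩

theorem QU_tendsto (H : KerHyp g K k) (hki : Integrable k) (hw : Measurable w)
    (hw1 : ∀ x, ‖w x‖ ≤ 1) (hN : NL G) (hμ : Measurable μ)
    (hh : Integrable h) (hU : Continuous U) (t : ℝ) {ε : ℝ} (hε : 0 < ε) :
    ∃ δ : ℝ, 0 < δ ∧ ∀ s, |s - t| < δ →
      (∀ x, ‖QU K ρ w μ hN h U s x - QU K ρ w μ hN h U t x‖ ≤ ε) ∧
      wOneInfNorm d g (fun x => QU K ρ w μ hN h U s x - QU K ρ w μ hN h U t x) <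
        ENNReal.ofReal ε := by
  have h1 := (BB_tendsto (g := g) (ρ := ρ) H hki hN hμ hh hU t).eventually (gt_mem_nhds hε)
  obtain ⟨δ, hδ, hb⟩ := Metric.eventually_nhds_iff.mp h1
  refine ⟨δ, hδ, fun s hs => ?_⟩
  have hB := hb (y := s) (by rwa [Real.dist_eq])
  have hA := (Fop_adm hN hU s).sub (Fop_adm hN hU t)
  have hi := (hv_integrable hμ hh s).sub (hv_integrable hμ hh t)
  have e : ∀ x, QU K ρ w μ hN h U s x - QU K ρ w μ hN h U t x = _ := fun x =>
    QQ_sub H hki hw hw1 (Fop_adm hN hU s) (Fop_adm hN hU t) (hv_integrable hμ hh s)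
      (hv_integrable hμ hh t) x
  simp_rw [e]
  exact ⟨fun x => (QQ_norm_le H hki hw hw1 hA x).trans hB.le,
    (QQ_w_le H hki hw hw1 hA hi).trans_lt ((ENNReal.ofReal_lt_ofReal_iff hε).mpr hB)⟩
end

end PartSec10

section PartSec11

set_option linter.unusedSectionVars false
/-! ## Part 11: stability and fixed point -/
open scoped BoundedContinuousFunction

section
variable {d : ℕ} {g : SchwartzMap (EuclideanSpace ℝ (Fin d)) ℂ}
  {K : ℝ → EuclideanSpace ℝ (Fin d) → ℂ} {k : ℝ → ℝ}
  {ρ : Measure (EuclideanSpace ℝ (Fin d))} [IsFiniteMeasure ρ]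
  {w : EuclideanSpace ℝ (Fin d) → ℂ} {μ : EuclideanSpace ℝ (Fin d) → ℝ} {G : ℂ → ℂ}

theorem integrable_exp_weight (H : KerHyp g K k) (hki : Integrable k) {l : ℝ} (hl : 0 < l) :
    IntegrableOn (fun s => k s * Real.exp (-(l * s))) (Set.Ioi 0) := by
  have hm : Measurable fun s : ℝ => k s * Real.exp (-(l * s)) := H.kmeas.mul (by fun_prop)
  refine Integrable.mono hki.integrableOn hm.aestronglyMeasurable ?_
  refine (ae_restrict_iff' measurableSet_Ioi).mpr (Filter.Eventually.of_forall fun s hs => ?_)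
  rw [norm_mul, Real.norm_of_nonneg (Real.exp_pos _).le]
  refine mul_le_of_le_one_right (norm_nonneg _) ?_
  rw [Real.exp_le_one_iff]
  have : (0:ℝ) < s := hs
  have : 0 ≤ l * s := by positivity
  linarith

theorem stability (H : KerHyp g K k) (hki : Integrable k) (hw : Measurable w)
    (hw1 : ∀ x, ‖w x‖ ≤ 1) (hN : NL G) (hμ : Measurable μ) (M : ℝ) :
    ∃ L : ℝ, 0 ≤ L ∧ ∀ T : ℝ, T ≤ 1 → ∀ h h' : EuclideanSpace ℝ (Fin d) → ℂ, Integrable h →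
      Integrable h' → ∀ U U' : ℝ → EuclideanSpace ℝ (Fin d) →ᵇ ℂ, Continuous U → Continuous U' →
      (∀ r ∈ Set.Icc 0 T, ‖U r‖ ≤ M) → (∀ r ∈ Set.Icc 0 T, ‖U' r‖ ≤ M) →
      (∀ t ∈ Set.Icc 0 T, ∀ x, U t x = QU K ρ w μ hN h U t x) →
      (∀ t ∈ Set.Icc 0 T, ∀ x, U' t x = QU K ρ w μ hN h' U' t x) →
      ∀ t ∈ Set.Icc 0 T, ‖U t - U' t‖ ≤ L * ∫ ξ, ‖h ξ - h' ξ‖ := by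
  obtain ⟨Λ, hΛ, hlip⟩ := hN.lip M
  set κ : ℝ := 2 * π * ρ.real Set.univ * Λ with hκ
  have hκ0 : 0 ≤ κ := by positivity
  obtain ⟨l, hl, hq⟩ := exp_weight H hki (ε := 1 / (2 * (κ + 1))) (by positivity)
  set q : ℝ := ∫ s in Set.Ioi 0, k s * Real.exp (-(l * s)) with hqdef
  have hq0 : 0 ≤ q := integral_nonneg fun s => mul_nonneg (H.nonneg s) (Real.exp_pos _).le
  have hκq : κ * q ≤ 1 / 2 := by
    rw [lt_div_iff₀ (by positivity)] at hq
    nlinarith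
  have hA : 0 ≤ AA g := zero_le_one.trans (AA_one g)
  refine ⟨2 * AA g * Real.exp l, by positivity, fun T hT h h' hh hh' U U' hU hU' hM hM' he he' => ?_⟩
  rcases lt_or_ge T 0 with hT0 | hT0
  · intro t ht; exact absurd (ht.1.trans ht.2) (not_le.mpr hT0)
  set δ : ℝ := ∫ ξ, ‖h ξ - h' ξ‖ with hδ
  have hδ0 : 0 ≤ δ := integral_nonneg fun _ => norm_nonneg _
  have hcont : Continuous fun t => Real.exp (-(l * t)) * ‖U t - U' t‖ := by fun_prop
  obtain ⟨t0, ht0, hmax⟩ := (isCompact_Icc (a := (0 : ℝ)) (b := T)).exists_isMaxOn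
    ⟨0, le_rfl, hT0⟩ hcont.continuousOn
  set N : ℝ := Real.exp (-(l * t0)) * ‖U t0 - U' t0‖ with hNdef
  have hN0 : 0 ≤ N := by positivity
  have hD : ∀ r ∈ Set.Icc 0 T, ‖U r - U' r‖ ≤ N * Real.exp (l * r) := by
    intro r hr
    have h1 : Real.exp (-(l * r)) * ‖U r - U' r‖ ≤ N := hmax hr
    rw [Real.exp_neg] at h1
    rwa [inv_mul_le_iff₀ (Real.exp_pos _), mul_comm] at h1
  have hsub : ∀ r ∈ Set.Icc 0 t0, r ∈ Set.Icc 0 T := fun r hr => ⟨hr.1, hr.2.trans ht0.2⟩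
  have hdiff := (QU_diff (ρ := ρ) (K := K) (w := w) H hki hw hw1 hN hμ hh hh' hU hU' hΛ hlip (t := t0)
    (fun r hr => hM r (hsub r hr)) (fun r hr => hM' r (hsub r hr))
    (D := fun r => N * Real.exp (l * r)) (by fun_prop) (fun r hr => hD r (hsub r hr))).1
  have hintg : ∫ s in Set.Ioo 0 t0, k s * (N * Real.exp (l * (t0 - s))) ≤
      N * Real.exp (l * t0) * q := by
    have e : ∀ s, k s * (N * Real.exp (l * (t0 - s))) =
        N * Real.exp (l * t0) * (k s * Real.exp (-(l * s))) := by
      intro s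
      rw [show l * (t0 - s) = l * t0 + -(l * s) by ring, Real.exp_add]; ring
    simp_rw [e]
    rw [integral_const_mul]
    refine mul_le_mul_of_nonneg_left ?_ (by positivity)
    refine setIntegral_mono_set (integrable_exp_weight H hki hl) ?_ ?_
    · exact Filter.Eventually.of_forall fun s => mul_nonneg (H.nonneg s) (Real.exp_pos _).le
    · exact (Set.Ioo_subset_Ioi_self).eventuallyLE
  have hb : ‖U t0 - U' t0‖ ≤ AA g * δ + κ * (N * Real.exp (l * t0) * q) := by
    have h0 : 0 ≤ AA g * δ + κ * (N * Real.exp (l * t0) * q) := by positivity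
    refine (BoundedContinuousFunction.norm_le h0).mpr fun x => ?_
    rw [BoundedContinuousFunction.sub_apply, he t0 ht0, he' t0 ht0]
    refine (hdiff x).trans ?_
    gcongr
  have hNle : N ≤ 2 * (AA g * δ) := by
    have h1 : N ≤ Real.exp (-(l * t0)) * (AA g * δ + κ * (N * Real.exp (l * t0) * q)) := by
      rw [hNdef]; gcongr
    have h2 : Real.exp (-(l * t0)) * Real.exp (l * t0) = 1 := by
      rw [← Real.exp_add]; simp
    have h3 : Real.exp (-(l * t0)) ≤ 1 := by
      rw [Real.exp_le_one_iff]
      have := mul_nonneg hl.le ht0.1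
      linarith
    have h4 : Real.exp (-(l * t0)) * (AA g * δ + κ * (N * Real.exp (l * t0) * q)) =
        Real.exp (-(l * t0)) * (AA g * δ) +
          (Real.exp (-(l * t0)) * Real.exp (l * t0)) * (N * (κ * q)) := by ring
    rw [h4, h2] at h1
    have h5 : Real.exp (-(l * t0)) * (AA g * δ) ≤ AA g * δ :=
      mul_le_of_le_one_left (by positivity) h3
    have h6 : N * (κ * q) ≤ N * (1 / 2) := by gcongr
    linarith
  intro t ht
  refine (hD t ht).trans ?_
  have h7 : Real.exp (l * t) ≤ Real.exp l := by
    refine Real.exp_le_exp.mpr ?_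
    have : t ≤ 1 := ht.2.trans hT
    nlinarith
  calc N * Real.exp (l * t) ≤ (2 * (AA g * δ)) * Real.exp l := by gcongr
    _ = _ := by ring

theorem existence (H : KerHyp g K k) (hki : Integrable k) (hw : Measurable w)
    (hw1 : ∀ x, ‖w x‖ ≤ 1) (hN : NL G) (hμ : Measurable μ) (R : ℝ) (hR : 0 < R) :
    ∃ T : ℝ, 0 < T ∧ T ≤ 1 ∧ ∀ h : EuclideanSpace ℝ (Fin d) → ℂ, Integrable h →
      ∫ ξ, ‖h ξ‖ ≤ R → ∃ U : ℝ → EuclideanSpace ℝ (Fin d) →ᵇ ℂ, Continuous U ∧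
      (∀ r, ‖U r‖ ≤ AA g * R + 1) ∧
      (∀ t ∈ Set.Icc 0 T, ∀ x, U t x = QU K ρ w μ hN h U t x) := by
  have hA : 0 < AA g := zero_lt_one.trans_le (AA_one g)
  set M : ℝ := AA g * R + 1 with hMdef
  have hM1 : 1 ≤ M := by have := mul_pos hA hR; linarith
  obtain ⟨Λ, hΛ, hlip⟩ := hN.lip M
  set κ : ℝ := 2 * π * ρ.real Set.univ * Λ with hκ
  have hκ0 : 0 ≤ κ := by positivity
  obtain ⟨l, hl, hq⟩ := exp_weight H hki (ε := 1 / (2 * (κ * M * Real.exp 1 + 1))) (by positivity)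
  set q : ℝ := ∫ s in Set.Ioi 0, k s * Real.exp (-(l * s)) with hqdef
  have hq0 : 0 ≤ q := integral_nonneg fun s => mul_nonneg (H.nonneg s) (Real.exp_pos _).le
  set T : ℝ := min 1 (1 / l) with hTdef
  have hT : 0 < T := lt_min one_pos (by positivity)
  set c : ℝ := ∫ s in Set.Ioo 0 T, k s with hcdef
  have hc0 : 0 ≤ c := integral_nonneg fun s => H.nonneg s
  have hcq : c ≤ Real.exp 1 * q := by
    rw [hqdef, ← integral_const_mul, hcdef]
    calc ∫ s in Set.Ioo 0 T, k s
        ≤ ∫ s in Set.Ioo 0 T, Real.exp 1 * (k s * Real.exp (-(l * s))) := by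
          refine setIntegral_mono_on hki.integrableOn
            (((integrable_exp_weight H hki hl).mono_set Set.Ioo_subset_Ioi_self).const_mul _)
            measurableSet_Ioo fun s hs => ?_
          have h1 : l * s ≤ 1 := by
            have : s ≤ 1 / l := hs.2.le.trans (min_le_right _ _)
            rwa [le_div_iff₀ hl, mul_comm] at this
          rw [mul_left_comm, ← Real.exp_add]
          refine le_mul_of_one_le_right (H.nonneg s) (Real.one_le_exp (by linarith))
      _ ≤ _ := by
          refine setIntegral_mono_set ((integrable_exp_weight H hki hl).const_mul _) ?_ ?_
          · exact Filter.Eventually.of_forall fun s => mul_nonneg (Real.exp_pos _).le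
              (mul_nonneg (H.nonneg s) (Real.exp_pos _).le)
          · exact (Set.Ioo_subset_Ioi_self).eventuallyLE
  have hsm : κ * M * c ≤ 1 / 2 := by
    rw [lt_div_iff₀ (by positivity)] at hq
    have : κ * M * c ≤ κ * M * (Real.exp 1 * q) := by gcongr
    nlinarith
  have hsm2 : κ * c ≤ 1 / 2 := by
    have : κ * c * 1 ≤ κ * c * M := by gcongr
    nlinarith
  have hct : ∀ t ≤ T, ∫ s in Set.Ioo 0 t, k s ≤ c := fun t ht =>
    setIntegral_mono_set hki.integrableOn (Filter.Eventually.of_forall fun s => H.nonneg s)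
      (Set.Ioo_subset_Ioo_right ht).eventuallyLE
  refine ⟨T, hT, min_le_left _ _, fun h hh hhR => ?_⟩
  -- projection to the interval
  set P : ℝ → ℝ := fun t => max 0 (min t T) with hP
  have hPc : Continuous P := by fun_prop
  have hPm : ∀ t, P t ∈ Set.Icc 0 T := fun t => ⟨le_max_left _ _, max_le hT.le (min_le_right _ _)⟩
  have hPid : ∀ t ∈ Set.Icc 0 T, P t = t := fun t ht => by
    simp only [hP]; rw [min_eq_left ht.2, max_eq_right ht.1]
  -- key estimates
  have key : ∀ U U' : ℝ → EuclideanSpace ℝ (Fin d) →ᵇ ℂ, Continuous U → Continuous U' →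
      (∀ r, ‖U r‖ ≤ M) → (∀ r, ‖U' r‖ ≤ M) → ∀ D : ℝ, (∀ r, ‖U r - U' r‖ ≤ D) →
      ∀ t ∈ Set.Icc 0 T, ∀ x, ‖QU K ρ w μ hN h U t x - QU K ρ w μ hN h U' t x‖ ≤ κ * c * D := by
    intro U U' hU hU' hM hM' D hD t ht x
    have hD0 : 0 ≤ D := (norm_nonneg _).trans (hD 0)
    refine ((QU_diff (ρ := ρ) (K := K) (w := w) H hki hw hw1 hN hμ hh hh hU hU' hΛ hlip (t := t)
      (fun r _ => hM r) (fun r _ => hM' r)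
      (D := fun _ => D) (by fun_prop) (fun r _ => hD r)).1 x).trans ?_
    simp only [sub_self, norm_zero, integral_zero, mul_zero, zero_add]
    rw [integral_mul_const, ← mul_assoc]
    gcongr
    exact hct t ht.2
  have key0 : ∀ t ∈ Set.Icc 0 T, ∀ x, ‖QU K ρ w μ hN h (fun _ => 0) t x‖ ≤ AA g * R := by
    intro t ht x
    unfold QU
    refine (QQ_norm_le H hki hw hw1 (Fop_adm hN continuous_const t) x).trans ?_
    have : ∀ s, Fop hN (fun _ => (0 : EuclideanSpace ℝ (Fin d) →ᵇ ℂ)) t s = 0 := by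
      intro s; unfold Fop; simp [nem_zero]
    unfold BB
    simp_rw [this, hv_norm]
    simp only [norm_zero, mul_zero, integral_zero, add_zero]
    gcongr
  -- the map at a given continuous U, as a bounded continuous function
  have qc : ∀ U : ℝ → EuclideanSpace ℝ (Fin d) →ᵇ ℂ, Continuous U → ∀ t,
      Continuous (QU K ρ w μ hN h U t) := fun U hU t =>
    QQ_continuous H hki hw hw1 (Fop_adm hN hU t) (hv_integrable hμ hh t)
  have qb : ∀ U : ℝ → EuclideanSpace ℝ (Fin d) →ᵇ ℂ, Continuous U → ∀ t x,
      ‖QU K ρ w μ hN h U t x‖ ≤ BB g k ρ (hv μ h t) (Fop hN U t) := fun U hU t x =>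
    QQ_norm_le H hki hw hw1 (Fop_adm hN hU t) x
  let B : (ℝ →ᵇ (EuclideanSpace ℝ (Fin d) →ᵇ ℂ)) → ℝ → (EuclideanSpace ℝ (Fin d) →ᵇ ℂ) :=
    fun U t => BoundedContinuousFunction.ofNormedAddCommGroup (QU K ρ w μ hN h U (P t))
      (qc U U.continuous _) _ (qb U U.continuous _)
  have Bapp : ∀ U t x, B U t x = QU K ρ w μ hN h U (P t) x := fun _ _ _ => rfl
  have Bc : ∀ U, Continuous (B U) := by
    intro U
    have h1 : ∀ t : ℝ, ∀ ε > 0, ∃ δ > 0, ∀ s, |s - t| < δ →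
      ∀ x, ‖QU K ρ w μ hN h U s x - QU K ρ w μ hN h U t x‖ ≤ ε := by
      intro t ε hε
      obtain ⟨δ, hδ, hb⟩ := QU_tendsto (g := g) (K := K) (ρ := ρ) H hki hw hw1 hN hμ hh
        U.continuous t hε
      exact ⟨δ, hδ, fun s hs => (hb s hs).1⟩
    rw [Metric.continuous_iff]
    intro t ε hε
    obtain ⟨δ, hδ, hb⟩ := h1 (P t) (ε / 2) (by positivity)
    obtain ⟨η, hη, hb'⟩ := Metric.continuous_iff.mp hPc t δ hδ
    refine ⟨η, hη, fun s hs => ?_⟩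
    have h2 := hb' s hs
    rw [Real.dist_eq] at h2
    rw [dist_eq_norm]
    refine lt_of_le_of_lt ((BoundedContinuousFunction.norm_le (by positivity)).mpr fun x => ?_)
      (half_lt_self hε)
    rw [BoundedContinuousFunction.sub_apply, Bapp, Bapp]
    exact hb _ h2 x
  have Bb : ∀ U, ∃ C, ∀ t, ‖B U t‖ ≤ C := by
    intro U
    have hBP : ∀ t, B U t = B U (P t) := by
      intro t; ext x; rw [Bapp, Bapp, hPid (P t) (hPm t)]
    obtain ⟨C, hC⟩ := (isCompact_Icc (a := (0 : ℝ)) (b := T)).bddAbove_image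
      (Bc U).norm.continuousOn
    exact ⟨C, fun t => by rw [hBP]; exact hC ⟨P t, hPm t, rfl⟩⟩
  choose C hC using Bb
  let Ψ : (ℝ →ᵇ (EuclideanSpace ℝ (Fin d) →ᵇ ℂ)) → (ℝ →ᵇ (EuclideanSpace ℝ (Fin d) →ᵇ ℂ)) :=
    fun U => BoundedContinuousFunction.ofNormedAddCommGroup (B U) (Bc U) (C U) (hC U)
  have Ψapp : ∀ U t, Ψ U t = B U t := fun _ _ => rfl
  set S : Set (ℝ →ᵇ (EuclideanSpace ℝ (Fin d) →ᵇ ℂ)) := Metric.closedBall 0 M with hS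
  have hSm : ∀ U ∈ S, ∀ r, ‖U r‖ ≤ M := by
    intro U hU r
    refine (U.norm_coe_le_norm r).trans ?_
    rwa [hS, mem_closedBall_zero_iff] at hU
  have hcon : ∀ U ∈ S, ∀ U' ∈ S, ‖Ψ U - Ψ U'‖ ≤ (1 / 2) * ‖U - U'‖ := by
    intro U hU U' hU'
    refine (BoundedContinuousFunction.norm_le (by positivity)).mpr fun t => ?_
    rw [BoundedContinuousFunction.sub_apply, Ψapp, Ψapp]
    refine (BoundedContinuousFunction.norm_le (by positivity)).mpr fun x => ?_
    rw [BoundedContinuousFunction.sub_apply, Bapp, Bapp]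
    refine (key U U' U.continuous U'.continuous (hSm U hU) (hSm U' hU') ‖U - U'‖
      (fun r => (U - U').norm_coe_le_norm r) (P t) (hPm t) x).trans ?_
    gcongr
  have hmaps : Set.MapsTo Ψ S S := by
    intro U hU
    rw [hS, mem_closedBall_zero_iff]
    refine (BoundedContinuousFunction.norm_le (by positivity)).mpr fun t => ?_
    rw [Ψapp]
    refine (BoundedContinuousFunction.norm_le (by positivity)).mpr fun x => ?_
    rw [Bapp]
    have h1 := key U (fun _ => 0) U.continuous continuous_const (hSm U hU)
      (fun r => by rw [norm_zero]; linarith) M (fun r => by rw [sub_zero]; exact hSm U hU r)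
      (P t) (hPm t) x
    have h2 := key0 (P t) (hPm t) x
    have h3 : κ * c * M ≤ 1 := by nlinarith
    have h4 := norm_sub_norm_le (QU K ρ w μ hN h U (P t) x) (QU K ρ w μ hN h (fun _ => 0) (P t) x)
    linarith
  have hctr : ContractingWith (1 / 2) (hmaps.restrict Ψ S S) := by
    refine ⟨by rw [← NNReal.coe_lt_coe]; norm_num, LipschitzWith.of_dist_le_mul fun U U' => ?_⟩
    rw [Subtype.dist_eq, Subtype.dist_eq, dist_eq_norm, dist_eq_norm]
    simpa using hcon U.1 U.2 U'.1 U'.2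
  obtain ⟨U, hUS, hUf, -⟩ := ContractingWith.exists_fixedPoint' (f := Ψ)
    (Metric.isClosed_closedBall.isComplete) hmaps hctr
    (x := 0) (by rw [mem_closedBall_zero_iff, norm_zero]; linarith) (edist_ne_top _ _)
  refine ⟨U, U.continuous, hSm U hUS, fun t ht x => ?_⟩
  have h1 : Ψ U = U := hUf
  have h2 : U t x = Ψ U t x := by rw [h1]
  rw [h2, Ψapp, Bapp, hPid t ht]
end

end PartSec11

section PartSec12

set_option linter.unusedSectionVars false
/-! ## Part 12: solutions versus the fixed point equation -/
open scoped BoundedContinuousFunction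

section
variable {d : ℕ} {g : SchwartzMap (EuclideanSpace ℝ (Fin d)) ℂ}
  {K : ℝ → EuclideanSpace ℝ (Fin d) → ℂ} {k : ℝ → ℝ}
  {ρ : Measure (EuclideanSpace ℝ (Fin d))} [IsFiniteMeasure ρ]
  {w : EuclideanSpace ℝ (Fin d) → ℂ} {μ : EuclideanSpace ℝ (Fin d) → ℝ} {G : ℂ → ℂ}
  {h : EuclideanSpace ℝ (Fin d) → ℂ} {EE : ℝ → EuclideanSpace ℝ (Fin d) → ℂ}
  {U : ℝ → EuclideanSpace ℝ (Fin d) →ᵇ ℂ}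

theorem duh_unfold (H : KerHyp g K k) (hki : Integrable k) (hw : Measurable w)
    (hw1 : ∀ x, ‖w x‖ ≤ 1) (hN : NL G) (hKE : ∀ s, 0 < s → s ≤ 1 → K s = EE s)
    (hU : Continuous U) {t : ℝ} (ht1 : t ≤ 1) (x : EuclideanSpace ℝ (Fin d)) :
    (∀ s ∈ Set.Ioo 0 t, Integrable (fun y => EE (t - s) (x - y) * G (U s y) * w y) ρ) ∧
    IntegrableOn (fun s => ∫ y, EE (t - s) (x - y) * G (U s y) * w y ∂ρ) (Set.Ioo 0 t) volume ∧
    duh K ρ (phi w (Fop hN U t)) x =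
      ∫ s in Set.Ioo 0 t, ∫ y, EE (t - s) (x - y) * G (U s y) * w y ∂ρ := by
  have hF := Fop_adm hN hU t
  have hi := duh_integrable H (measurable_phi hw hF.sm) (wt_phi_lt (ρ := ρ) H hki hw hw1 hF) x
  have hcong : ∀ s, (∫ y, K (t - s) (x - y) * phi w (Fop hN U t) (t - s, y) ∂ρ) =
      (Set.Ioo 0 t).indicator (fun s => ∫ y, EE (t - s) (x - y) * G (U s y) * w y ∂ρ) s := by
    intro s
    by_cases hs : s ∈ Set.Ioo 0 t
    · rw [Set.indicator_of_mem hs]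
      refine integral_congr_ae (Filter.Eventually.of_forall fun y => ?_)
      have hs' : t - s ∈ Set.Ioo 0 t := ⟨by linarith [hs.2], by linarith [hs.1]⟩
      simp only [phi, Fop]
      rw [Set.indicator_of_mem hs', sub_sub_cancel, nem_apply,
        hKE (t - s) hs'.1 (by linarith [hs'.2]), mul_assoc]
    · rw [Set.indicator_of_notMem hs]
      have hs' : t - s ∉ Set.Ioo 0 t := fun h => hs ⟨by linarith [h.2], by linarith [h.1]⟩
      simp only [phi, Fop]
      rw [Set.indicator_of_notMem hs']
      simp
  have hintg : Integrable (fun s => ∫ y, K s (x - y) * phi w (Fop hN U t) (s, y) ∂ρ) volume :=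
    hi.integral_prod_left
  refine ⟨fun s hs => ?_, ?_, ?_⟩
  · have hs' : t - s ∈ Set.Ioo 0 t := ⟨by linarith [hs.2], by linarith [hs.1]⟩
    rw [← hKE (t - s) hs'.1 (by linarith [hs'.2])]
    refine Integrable.of_bound (C := k (t - s) * ‖nem hN (U s)‖ * 1) ?_
      (Filter.Eventually.of_forall fun y => ?_)
    · have h1 : Continuous fun y => K (t - s) (x - y) := (H.cont (t - s)).comp (by fun_prop)
      have h2 : Continuous fun y => G (U s y) := hN.continuous.comp (U s).continuous
      exact (((h1.mul h2).measurable).mul hw).aestronglyMeasurable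
    · rw [norm_mul, norm_mul]
      have h3 := H.nonneg (t - s)
      gcongr
      · exact H.le _ _
      · exact (nem hN (U s)).norm_coe_le_norm y
      · exact hw1 y
  · rw [← integrable_indicator_iff measurableSet_Ioo]
    have := hintg.comp_sub_left t
    refine this.congr (Filter.Eventually.of_forall fun s => ?_)
    exact hcong s
  · unfold duh
    rw [integral_prod _ hi, ← integral_indicator measurableSet_Ioo,
      ← integral_sub_left_eq_self _ volume t]
    exact integral_congr_ae (Filter.Eventually.of_forall hcong)

theorem invF_hv (t : ℝ) (x : EuclideanSpace ℝ (Fin d)) :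
    invF (hv μ h t) x = ∫ (ξ : EuclideanSpace ℝ (Fin d)),
        Complex.exp (((2 * Real.pi * (⟪x, ξ⟫ + t * μ ξ) : ℝ) : ℂ) * Complex.I) * h ξ := by
  unfold invF hv
  congr 1; ext ξ
  rw [← mul_assoc, ← ee_add]
  rfl

theorem QU_zero (hN : NL G) (x : EuclideanSpace ℝ (Fin d)) :
    QU K ρ w μ hN h U 0 x = ∫ (ξ : EuclideanSpace ℝ (Fin d)),
      Complex.exp (((2 * Real.pi * ⟪x, ξ⟫ : ℝ) : ℂ) * Complex.I) * h ξ := by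
  have h1 : ∀ p, phi w (Fop hN U 0) p = 0 := by
    intro p; simp [phi, Fop]
  have h2 : duh K ρ (phi w (Fop hN U 0)) x = 0 := by
    unfold duh; simp [h1]
  unfold QU QQ
  rw [h2, invF_hv]
  simp

theorem sol_of (H : KerHyp g K k) (hki : Integrable k) (hw : Measurable w)
    (hw1 : ∀ x, ‖w x‖ ≤ 1) (hN : NL G) (hμ : Measurable μ)
    (hKE : ∀ s, 0 < s → s ≤ 1 → K s = EE s) (hh : Integrable h)
    (hU : Continuous U) {T : ℝ} (hT0 : 0 < T) (hT1 : T ≤ 1)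
    (he : ∀ t ∈ Set.Icc 0 T, ∀ x, U t x = QU K ρ w μ hN h U t x) :
    IsSolutionOn d T μ g EE ρ w G h (fun t x => U t x) := by
  refine ⟨fun t ht => ⟨(U t).continuous, ⟨‖U t‖, (U t).norm_coe_le_norm⟩, ?_⟩,
    fun t ht ε hε => ?_, fun x => ?_, fun t ht x => ?_⟩
  · change wOneInfNorm d g (fun x => U t x) < ⊤
    rw [show (fun x => U t x) = QU K ρ w μ hN h U t from funext (he t ht)]
    exact (QQ_w_le H hki hw hw1 (Fop_adm hN hU t) (hv_integrable hμ hh t)).trans_lt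
      ENNReal.ofReal_lt_top
  · obtain ⟨δ, hδ, hb⟩ := QU_tendsto (g := g) (K := K) (ρ := ρ) H hki hw hw1 hN hμ hh hU t hε
    refine ⟨δ, hδ, fun s hs hst => ?_⟩
    simp only
    simp_rw [he s hs, he t ht]
    exact (hb s hst).2
  · simp only
    rw [he 0 ⟨le_rfl, hT0.le⟩, QU_zero]
  · obtain ⟨h1, h2, h3⟩ := duh_unfold (ρ := ρ) H hki hw hw1 hN hKE hU (ht.2.trans hT1) x
    refine ⟨h1, h2, ?_⟩
    simp only
    rw [he t ⟨ht.1.le, ht.2⟩, ← h3, ← invF_hv]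
    rfl

theorem of_sol (hg : g 0 ≠ 0) (H : KerHyp g K k) (hki : Integrable k) (hw : Measurable w)
    (hw1 : ∀ x, ‖w x‖ ≤ 1) (hN : NL G)
    (hKE : ∀ s, 0 < s → s ≤ 1 → K s = EE s)
    {T : ℝ} (hT0 : 0 < T) (hT1 : T ≤ 1) {u : ℝ → EuclideanSpace ℝ (Fin d) → ℂ}
    (hu : IsSolutionOn d T μ g EE ρ w G h u) :
    ∃ U : ℝ → EuclideanSpace ℝ (Fin d) →ᵇ ℂ, Continuous U ∧
      (∀ t ∈ Set.Icc 0 T, ∀ x, u t x = U t x) ∧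
      (∀ t ∈ Set.Icc 0 T, ∀ x, U t x = QU K ρ w μ hN h U t x) := by
  obtain ⟨hu1, hu2, hu3, hu4⟩ := hu
  set P : ℝ → ℝ := fun t => max 0 (min t T) with hP
  have hPc : Continuous P := by fun_prop
  have hPm : ∀ t, P t ∈ Set.Icc 0 T := fun t =>
    ⟨le_max_left _ _, max_le hT0.le (min_le_right _ _)⟩
  have hPid : ∀ t ∈ Set.Icc 0 T, P t = t := fun t ht => by
    simp only [hP]; rw [min_eq_left ht.2, max_eq_right ht.1]
  let U : ℝ → EuclideanSpace ℝ (Fin d) →ᵇ ℂ := fun t =>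
    BoundedContinuousFunction.ofNormedAddCommGroup (u (P t)) (hu1 _ (hPm t)).1
      (hu1 _ (hPm t)).2.1.choose (hu1 _ (hPm t)).2.1.choose_spec
  have Uapp : ∀ t x, U t x = u (P t) x := fun _ _ => rfl
  have hUu : ∀ t ∈ Set.Icc 0 T, ∀ x, U t x = u t x := fun t ht x => by rw [Uapp, hPid t ht]
  have hg0 : 0 < ‖g 0‖ := norm_pos_iff.mpr hg
  have hUc : Continuous U := by
    rw [Metric.continuous_iff]
    intro t ε hε
    obtain ⟨δ, hδ, hb⟩ := hu2 (P t) (hPm t) (ε / 2 * ‖g 0‖) (by positivity)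
    obtain ⟨η, hη, hb'⟩ := Metric.continuous_iff.mp hPc t δ hδ
    refine ⟨η, hη, fun s hs => ?_⟩
    have h2 := hb' s hs
    rw [Real.dist_eq] at h2
    rw [dist_eq_norm]
    refine lt_of_le_of_lt ((BoundedContinuousFunction.norm_le (by positivity)).mpr fun x => ?_)
      (half_lt_self hε)
    have h3 := (sup_le_gabor g (U s - U t).continuous (U s - U t).norm_coe_le_norm x).trans
      (hb (P s) (hPm s) h2).le
    rw [← ofReal_norm, ← ofReal_norm, ← ENNReal.ofReal_mul (norm_nonneg _),
      ENNReal.ofReal_le_ofReal_iff (by positivity)] at h3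
    exact le_of_mul_le_mul_right h3 hg0
  refine ⟨U, hUc, fun t ht x => (hUu t ht x).symm, fun t ht x => ?_⟩
  rcases eq_or_lt_of_le ht.1 with h0 | h0
  · subst h0
    rw [QU_zero, hUu 0 ht, hu3]
  · obtain ⟨-, -, h3⟩ := duh_unfold (ρ := ρ) H hki hw hw1 hN hKE hUc (ht.2.trans hT1) x
    rw [hUu t ht, (hu4 t ⟨h0, ht.2⟩ x).2.2]
    unfold QU QQ
    rw [h3, invF_hv]
    congr 2
    refine setIntegral_congr_fun measurableSet_Ioo fun s hs => ?_
    simp_rw [hUu s ⟨hs.1.le, hs.2.le.trans ht.2⟩]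
end

end PartSec12

/-- (Theorem 1.3, local wellposedness, time-independent measure potential.)
Under hypotheses (H) with `m > 2d`, for a finite complex Borel measure `ν = w dρ`, an entire
real-analytic nonlinearity `G` with `G(0) = 0`, and every `R > 0`, there is `T = T(R) ∈ (0,1]`
such that each datum `f = (h)^∨` with `‖h‖_{L¹} ≤ R` admits a unique solution
`u ∈ C⁰([0,T]; W^{1,∞})` of the Duhamel equation, and the datum-to-solution map is Lipschitz. -/
theorem local_wellposedness (d : ℕ) (hd : 1 ≤ d) (m : ℝ) (hm : 2 ≤ m)
    (hmd : 2 * (d : ℝ) < m)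
    (μ : EuclideanSpace ℝ (Fin d) → ℝ)
    (hsmooth : ContDiffOn ℝ (⊤ : ℕ∞) μ {x | x ≠ 0})
    (hhom : ∀ c : ℝ, 0 < c → ∀ x : EuclideanSpace ℝ (Fin d), x ≠ 0 →
      μ (c • x) = c ^ m * μ x)
    (hhess : ∀ x : EuclideanSpace ℝ (Fin d), ‖x‖ = 1 →
      Function.Bijective ⇑(fderiv ℝ (fderiv ℝ μ) x))
    (g : SchwartzMap (EuclideanSpace ℝ (Fin d)) ℂ) (hg : g 0 ≠ 0)
    (EE : ℝ → EuclideanSpace ℝ (Fin d) → ℂ)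
    (hEE : ∀ t : ℝ, 0 < t → Continuous (EE t) ∧ (∃ M : ℝ, ∀ x, ‖EE t x‖ ≤ M) ∧
      ∀ φ : SchwartzMap (EuclideanSpace ℝ (Fin d)) ℂ,
        ∫ x, EE t x * φ x =
          ∫ (ξ : EuclideanSpace ℝ (Fin d)),
            Complex.exp (((2 * Real.pi * (t * μ ξ) : ℝ) : ℂ) * Complex.I) *
              ∫ x, Complex.exp (((2 * Real.pi * ⟪ξ, x⟫ : ℝ) : ℂ) * Complex.I) * φ x)
    (ρ : Measure (EuclideanSpace ℝ (Fin d))) [IsFiniteMeasure ρ]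
    (w : EuclideanSpace ℝ (Fin d) → ℂ) (hwm : Measurable w) (hw1 : ∀ y, ‖w y‖ ≤ 1)
    (G : ℂ → ℂ) (c : ℕ → ℕ → ℂ)
    (hc : ∀ r : ℝ, 0 < r →
      Summable (fun jk : ℕ × ℕ => ‖c jk.1 jk.2‖ * r ^ (jk.1 + jk.2)))
    (hG : ∀ z : ℂ,
      HasSum (fun jk : ℕ × ℕ => c jk.1 jk.2 * z ^ jk.1 * ((starRingEnd ℂ) z) ^ jk.2) (G z))
    (hG0 : G 0 = 0)
    (R : ℝ) (hR : 0 < R) :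
    ∃ T : ℝ, 0 < T ∧ T ≤ 1 ∧
      (∀ h : EuclideanSpace ℝ (Fin d) → ℂ, Integrable h → (∫ ξ, ‖h ξ‖) ≤ R →
        ∃ u : ℝ → EuclideanSpace ℝ (Fin d) → ℂ,
          IsSolutionOn d T μ g EE ρ w G h u ∧
          ∀ u' : ℝ → EuclideanSpace ℝ (Fin d) → ℂ,
            IsSolutionOn d T μ g EE ρ w G h u' →
            ∀ t ∈ Set.Icc (0 : ℝ) T, ∀ x, u' t x = u t x) ∧
      (∃ L : ℝ, 0 < L ∧
        ∀ h₁ h₂ : EuclideanSpace ℝ (Fin d) → ℂ, Integrable h₁ → Integrable h₂ →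
          (∫ ξ, ‖h₁ ξ‖) ≤ R → (∫ ξ, ‖h₂ ξ‖) ≤ R →
          ∀ u₁ u₂ : ℝ → EuclideanSpace ℝ (Fin d) → ℂ,
            IsSolutionOn d T μ g EE ρ w G h₁ u₁ →
            IsSolutionOn d T μ g EE ρ w G h₂ u₂ →
            ∀ t ∈ Set.Icc (0 : ℝ) T,
              wOneInfNorm d g (fun x => u₁ t x - u₂ t x) ≤
                ENNReal.ofReal (L * ∫ ξ, ‖h₁ ξ - h₂ ξ‖)) := by
  have hμ : Measurable μ :=
    measurable_of_continuousOn_compl_singleton 0 (hsmooth.continuousOn)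
  have hN : NL G := NL_of_series G c hc hG hG0
  obtain ⟨K, k, H, hki, hKE, -⟩ :=
    kernel_exists d hd m hmd μ hsmooth hhom hhess g hg EE hEE
  obtain ⟨T, hT0, hT1, hex⟩ := existence (ρ := ρ) H hki hwm hw1 hN hμ R hR
  have hbound : ∀ U : ℝ → BoundedContinuousFunction (EuclideanSpace ℝ (Fin d)) ℂ, Continuous U →
      ∃ M : ℝ, ∀ r ∈ Set.Icc 0 T, ‖U r‖ ≤ M := by
    intro U hU
    obtain ⟨M, hM⟩ := (isCompact_Icc (a := (0 : ℝ)) (b := T)).bddAbove_image hU.norm.continuousOn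
    exact ⟨M, fun r hr => hM ⟨r, hr, rfl⟩⟩
  have huniq : ∀ h : EuclideanSpace ℝ (Fin d) → ℂ, Integrable h →
      ∀ U U' : ℝ → BoundedContinuousFunction (EuclideanSpace ℝ (Fin d)) ℂ,
      Continuous U → Continuous U' →
      (∀ t ∈ Set.Icc 0 T, ∀ x, U t x = QU K ρ w μ hN h U t x) →
      (∀ t ∈ Set.Icc 0 T, ∀ x, U' t x = QU K ρ w μ hN h U' t x) →
      ∀ t ∈ Set.Icc 0 T, U t = U' t := by
    intro h hh U U' hU hU' he he' t ht
    obtain ⟨M, hM⟩ := hbound U hU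
    obtain ⟨M', hM'⟩ := hbound U' hU'
    obtain ⟨L, -, hL⟩ := stability (ρ := ρ) H hki hwm hw1 hN hμ (max M M')
    have h1 := hL T hT1 h h hh hh U U' hU hU' (fun r hr => (hM r hr).trans (le_max_left _ _))
      (fun r hr => (hM' r hr).trans (le_max_right _ _)) he he' t ht
    simp only [sub_self, norm_zero, integral_zero, mul_zero] at h1
    exact sub_eq_zero.mp (norm_le_zero_iff.mp h1)
  refine ⟨T, hT0, hT1, fun h hh hhR => ?_, ?_⟩
  · obtain ⟨U, hU, hUM, he⟩ := hex h hh hhR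
    refine ⟨fun t x => U t x, sol_of H hki hwm hw1 hN hμ hKE hh hU hT0 hT1 he,
      fun u' hu' t ht x => ?_⟩
    obtain ⟨U', hU', huU, he'⟩ := of_sol hg H hki hwm hw1 hN hKE hT0 hT1 hu'
    rw [huU t ht x, huniq h hh U' U hU' hU he' he t ht]
  · obtain ⟨Lc, hLc0, hL⟩ := stability (ρ := ρ) H hki hwm hw1 hN hμ (AA g * R + 1)
    obtain ⟨Λ, hΛ, hlip⟩ := hN.lip (AA g * R + 1)
    have hk0 : 0 ≤ ∫ s, k s := integral_nonneg fun s => H.nonneg s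
    have hA : 0 < AA g := zero_lt_one.trans_le (AA_one g)
    refine ⟨AA g + 2 * Real.pi * ρ.real Set.univ * Λ * ((∫ s, k s) * Lc), by positivity,
      fun h₁ h₂ hh₁ hh₂ hR₁ hR₂ u₁ u₂ hu₁ hu₂ t ht => ?_⟩
    have hid : ∀ h : EuclideanSpace ℝ (Fin d) → ℂ, Integrable h → (∫ ξ, ‖h ξ‖) ≤ R →
        ∀ u, IsSolutionOn d T μ g EE ρ w G h u →
        ∃ U : ℝ → BoundedContinuousFunction (EuclideanSpace ℝ (Fin d)) ℂ, Continuous U ∧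
          (∀ t ∈ Set.Icc 0 T, ∀ x, u t x = U t x) ∧ (∀ r ∈ Set.Icc 0 T, ‖U r‖ ≤ AA g * R + 1) ∧
          (∀ t ∈ Set.Icc 0 T, ∀ x, U t x = QU K ρ w μ hN h U t x) := by
      intro h hh hhR u hu
      obtain ⟨U, hU, hUM, he⟩ := hex h hh hhR
      obtain ⟨U', hU', huU, he'⟩ := of_sol hg H hki hwm hw1 hN hKE hT0 hT1 hu
      refine ⟨U', hU', huU, fun r hr => ?_, he'⟩
      rw [huniq h hh U' U hU' hU he' he r hr]
      exact hUM r
    obtain ⟨U₁, hU₁, huU₁, hM₁, he₁⟩ := hid h₁ hh₁ hR₁ u₁ hu₁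
    obtain ⟨U₂, hU₂, huU₂, hM₂, he₂⟩ := hid h₂ hh₂ hR₂ u₂ hu₂
    have hst := hL T hT1 h₁ h₂ hh₁ hh₂ U₁ U₂ hU₁ hU₂ hM₁ hM₂ he₁ he₂
    have hsub : ∀ r ∈ Set.Icc 0 t, r ∈ Set.Icc 0 T := fun r hr => ⟨hr.1, hr.2.trans ht.2⟩
    have hδ : 0 ≤ ∫ ξ, ‖h₁ ξ - h₂ ξ‖ := integral_nonneg fun _ => norm_nonneg _
    have hd := (QU_diff (ρ := ρ) (K := K) (w := w) H hki hwm hw1 hN hμ hh₁ hh₂ hU₁ hU₂ hΛ hlip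
      (t := t) (fun r hr => hM₁ r (hsub r hr)) (fun r hr => hM₂ r (hsub r hr))
      (D := fun _ => Lc * ∫ ξ, ‖h₁ ξ - h₂ ξ‖) continuous_const
      (fun r hr => hst r (hsub r hr))).2
    simp_rw [huU₁ t ht, huU₂ t ht, he₁ t ht, he₂ t ht]
    refine hd.trans (ENNReal.ofReal_le_ofReal ?_)
    rw [integral_mul_const]
    have hkt : ∫ s in Set.Ioo 0 t, k s ≤ ∫ s, k s :=
      setIntegral_le_integral hki (Filter.Eventually.of_forall fun s => H.nonneg s)
    have h5 : 2 * Real.pi * ρ.real Set.univ * Λ *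
        ((∫ s in Set.Ioo 0 t, k s) * (Lc * ∫ ξ, ‖h₁ ξ - h₂ ξ‖)) ≤
        2 * Real.pi * ρ.real Set.univ * Λ * ((∫ s, k s) * (Lc * ∫ ξ, ‖h₁ ξ - h₂ ξ‖)) := by
      gcongr
    refine (add_le_add le_rfl h5).trans (le_of_eq ?_)
    ring
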